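/- For topological spaces X and Y, the connectivity of the join X * Y satisfies conn(X * Y) ≥ conn(X) + conn(Y) + 2. -/

import Mathlib

noncomputable section

/-- Extension property: every map from the k-sphere extends to the (k+1)-ball. -/
def SphereExt (X : Type*) [TopologicalSpace X] (k : ℕ) : Prop :=
  ∀ f : C((Metric.sphere (0 : EuclideanSpace ℝ (Fin (k+1))) 1), X),
    ∃ g : C((Metric.closedBall (0 : EuclideanSpace ℝ (Fin (k+1))) 1), X),
      ∀ z : (Metric.sphere (0 : EuclideanSpace ℝ (Fin (k+1))) 1),
        g ⟨z.1, Metric.sphere_subset_closedBall z.2⟩ = f z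

/-- `X` is `n`-connected (n : ℤ, n ≥ -1 meaningful): nonempty and every map
`S^k → X`, `0 ≤ k ≤ n`, extends over `B^{k+1}`. -/
def NConnected (X : Type*) [TopologicalSpace X] (n : ℤ) : Prop :=
  (-1 ≤ n → Nonempty X) ∧ ∀ k : ℕ, (k : ℤ) ≤ n → SphereExt X k

/-- `conn(X) = n` in the sense of the paper: `n`-connected but not `(n+1)`-connected. -/
def ConnEq (X : Type*) [TopologicalSpace X] (n : ℤ) : Prop :=
  NConnected X n ∧ ¬ NConnected X (n+1)

/-- The topological join `X * Y`: quotient of `X × Y × [0,1]` identifying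
`(x,y,0) ~ (x,y',0)` and `(x,y,1) ~ (x',y,1)`. -/
def TopJoin (X Y : Type*) [TopologicalSpace X] [TopologicalSpace Y] : Type _ :=
  Quot (fun a b : X × Y × unitInterval =>
    (a.2.2 = 0 ∧ b.2.2 = 0 ∧ a.1 = b.1) ∨ (a.2.2 = 1 ∧ b.2.2 = 1 ∧ a.2.1 = b.2.1))

instance (X Y : Type*) [TopologicalSpace X] [TopologicalSpace Y] :
    TopologicalSpace (TopJoin X Y) :=
  instTopologicalSpaceQuot

open Set Topology Filter

namespace TopJoin

variable {X Y : Type*} [TopologicalSpace X] [TopologicalSpace Y]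

/-- The point of the join with coordinates `(x, y, t)`. -/
def mk (x : X) (y : Y) (t : unitInterval) : TopJoin X Y := Quot.mk _ (x, y, t)

lemma continuous_mk : Continuous fun p : X × Y × unitInterval => mk p.1 p.2.1 p.2.2 :=
  continuous_quot_mk

lemma isQuotientMap_mk :
    IsQuotientMap fun p : X × Y × unitInterval => mk p.1 p.2.1 p.2.2 :=
  isQuotientMap_quot_mk

lemma mk_zero (x : X) (y y' : Y) : mk x y 0 = mk x y' 0 :=
  Quot.sound (Or.inl ⟨rfl, rfl, rfl⟩)

lemma mk_one (x x' : X) (y : Y) : mk x y 1 = mk x' y 1 :=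
  Quot.sound (Or.inr ⟨rfl, rfl, rfl⟩)

lemma mk_surjective (q : TopJoin X Y) : ∃ x y t, mk x y t = q := by
  induction q using Quot.ind with
  | mk p => exact ⟨p.1, p.2.1, p.2.2, rfl⟩

/-- The interval coordinate of a point of the join. -/
def height (q : TopJoin X Y) : ℝ :=
  Quot.lift (fun p : X × Y × unitInterval => (p.2.2 : ℝ)) (by
    rintro a b (⟨h, h', -⟩ | ⟨h, h', -⟩) <;> simp [h, h']) q

@[simp] lemma height_mk (x : X) (y : Y) (t : unitInterval) : height (mk x y t) = t := rfl

lemma continuous_height : Continuous (height : TopJoin X Y → ℝ) :=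
  isQuotientMap_mk.continuous_iff.2 (by
    change Continuous fun p : X × Y × unitInterval => (p.2.2 : ℝ)
    fun_prop)

open Classical in
/-- The `X`-coordinate of a point of the join, with a junk value at height `1`. -/
def fstCoord [Nonempty X] (q : TopJoin X Y) : X :=
  Quot.lift (fun p : X × Y × unitInterval => if p.2.2 = 1 then Classical.arbitrary X else p.1) (by
    rintro ⟨x, y, t⟩ ⟨x', y', t'⟩ (⟨h, h', h''⟩ | ⟨h, h', -⟩)
    · simp_all
    · simp_all) q

open Classical in
/-- The `Y`-coordinate of a point of the join, with a junk value at height `0`. -/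
def sndCoord [Nonempty Y] (q : TopJoin X Y) : Y :=
  Quot.lift (fun p : X × Y × unitInterval => if p.2.2 = 0 then Classical.arbitrary Y else p.2.1) (by
    rintro ⟨x, y, t⟩ ⟨x', y', t'⟩ (⟨h, h', -⟩ | ⟨h, h', h''⟩)
    · simp_all
    · simp_all) q

lemma fstCoord_mk [Nonempty X] (x : X) (y : Y) {t : unitInterval} (ht : t ≠ 1) :
    fstCoord (mk x y t) = x := by
  simp [fstCoord, mk, ht]

lemma sndCoord_mk [Nonempty Y] (x : X) (y : Y) {t : unitInterval} (ht : t ≠ 0) :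
    sndCoord (mk x y t) = y := by
  simp [sndCoord, mk, ht]

lemma continuousOn_fstCoord [Nonempty X] :
    ContinuousOn (fstCoord : TopJoin X Y → X) {q | height q < 1} := by
  refine (isQuotientMap_mk.continuousOn_isOpen_iff
    (isOpen_lt continuous_height continuous_const)).2 ?_
  refine (continuous_fst.continuousOn).congr fun p hp => fstCoord_mk _ _ ?_
  rintro h
  simp [h] at hp

lemma continuousOn_sndCoord [Nonempty Y] :
    ContinuousOn (sndCoord : TopJoin X Y → Y) {q | 0 < height q} := by
  refine (isQuotientMap_mk.continuousOn_isOpen_iff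
    (isOpen_lt continuous_const continuous_height)).2 ?_
  refine (continuous_snd.fst.continuousOn).congr fun p hp => sndCoord_mk _ _ ?_
  rintro h
  simp [h] at hp

/-- The piecewise linear map `ℝ → [0,1]` that is `0` up to `1/3` and `1` from `2/3` on. -/
def stretch (t : ℝ) : unitInterval := Set.projIcc 0 1 zero_le_one (3 * t - 1)

lemma continuous_stretch : Continuous stretch := by
  unfold stretch
  exact continuous_projIcc.comp (by fun_prop)

lemma stretch_of_le {t : ℝ} (h : t ≤ 1 / 3) : stretch t = 0 :=
  Set.projIcc_of_le_left _ (by linarith)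

lemma stretch_of_ge {t : ℝ} (h : 2 / 3 ≤ t) : stretch t = 1 :=
  Set.projIcc_of_right_le _ (by linarith)

variable {M : Type*} [TopologicalSpace M]

/-- A pair of partial maps to `X` and `Y`, together with a height function that avoids the end of
the join at which they are undefined, gives a continuous map to the join. -/
lemma continuous_mk_stretch {x : M → X} {y : M → Y} {τ : M → ℝ} (hτ : Continuous τ)
    (hx : ContinuousOn x {z | τ z < 1}) (hy : ContinuousOn y {z | 0 < τ z}) :
    Continuous fun z => mk (x z) (y z) (stretch (τ z)) := by
  have hxo : IsOpen {z | τ z < 1} := isOpen_lt hτ continuous_const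
  have hyo : IsOpen {z | 0 < τ z} := isOpen_lt continuous_const hτ
  have hs : Continuous fun z => stretch (τ z) := continuous_stretch.comp hτ
  refine continuous_iff_continuousAt.2 fun z => ?_
  rcases lt_or_ge (τ z) (1 / 3) with h | h
  · have hxz : ContinuousAt x z := hx.continuousAt (hxo.mem_nhds (by simp; linarith))
    refine ContinuousAt.congr (f := fun w => mk (x w) (y z) (stretch (τ w))) ?_ ?_
    · exact continuous_mk.continuousAt.comp (hxz.prodMk (continuousAt_const.prodMk hs.continuousAt))
    · filter_upwards [(isOpen_lt hτ continuous_const).mem_nhds h] with w hw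
      rw [stretch_of_le (le_of_lt hw)]
      exact mk_zero _ _ _
  rcases lt_or_ge (2 / 3) (τ z) with h' | h'
  · have hyz : ContinuousAt y z := hy.continuousAt (hyo.mem_nhds (by simp; linarith))
    refine ContinuousAt.congr (f := fun w => mk (x z) (y w) (stretch (τ w))) ?_ ?_
    · exact continuous_mk.continuousAt.comp (continuousAt_const.prodMk (hyz.prodMk hs.continuousAt))
    · filter_upwards [(isOpen_lt continuous_const hτ).mem_nhds h'] with w hw
      rw [stretch_of_ge (le_of_lt hw)]
      exact mk_one _ _ _
  · have hxz : ContinuousAt x z := hx.continuousAt (hxo.mem_nhds (by simp; linarith))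
    have hyz : ContinuousAt y z := hy.continuousAt (hyo.mem_nhds (by simp; linarith))
    exact continuous_mk.continuousAt.comp (hxz.prodMk (hyz.prodMk hs.continuousAt))

/-- Two functions are joined by a homotopy; their continuity is not part of the data. -/
def Homot {Z : Type*} [TopologicalSpace Z] (f g : M → Z) : Prop :=
  ∃ H : M × unitInterval → Z, Continuous H ∧ (∀ z, H (z, 0) = f z) ∧ ∀ z, H (z, 1) = g z

lemma Homot.trans {Z : Type*} [TopologicalSpace Z] {f g h : M → Z} (h₁ : Homot f g)
    (h₂ : Homot g h) : Homot f h := by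
  obtain ⟨H, hH, H0, H1⟩ := h₁
  obtain ⟨K, hK, K0, K1⟩ := h₂
  have hf : Continuous f := (hH.comp (Continuous.prodMk_left 0)).congr H0
  have hg : Continuous g := (hH.comp (Continuous.prodMk_left 1)).congr H1
  have hh : Continuous h := (hK.comp (Continuous.prodMk_left 1)).congr K1
  let F : ContinuousMap.Homotopy ⟨f, hf⟩ ⟨g, hg⟩ :=
    { toFun := fun p => H (p.2, p.1)
      continuous_toFun := hH.comp continuous_swap
      map_zero_left := H0
      map_one_left := H1 }
  let G : ContinuousMap.Homotopy ⟨g, hg⟩ ⟨h, hh⟩ :=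
    { toFun := fun p => K (p.2, p.1)
      continuous_toFun := hK.comp continuous_swap
      map_zero_left := K0
      map_one_left := K1 }
  exact ⟨fun p => F.trans G (p.2, p.1), (F.trans G).continuous.comp continuous_swap,
    fun z => (F.trans G).apply_zero z, fun z => (F.trans G).apply_one z⟩

lemma homot_height {x : M → X} {y : M → Y} {τ τ' : M → ℝ} (hτ : Continuous τ)
    (hτ' : Continuous τ') (hx : ContinuousOn x {z | τ z < 1})
    (hx' : ContinuousOn x {z | τ' z < 1}) (hy : ContinuousOn y {z | 0 < τ z})
    (hy' : ContinuousOn y {z | 0 < τ' z}) :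
    Homot (fun z => mk (x z) (y z) (stretch (τ z))) fun z => mk (x z) (y z) (stretch (τ' z)) := by
  refine ⟨fun p => mk (x p.1) (y p.1) (stretch ((1 - p.2) * τ p.1 + p.2 * τ' p.1)), ?_, ?_, ?_⟩
  · have hxc : ContinuousOn x ({z | τ z < 1} ∪ {z | τ' z < 1}) :=
      hx.union_of_isOpen hx' (isOpen_lt hτ continuous_const) (isOpen_lt hτ' continuous_const)
    have hyc : ContinuousOn y ({z | 0 < τ z} ∪ {z | 0 < τ' z}) :=
      hy.union_of_isOpen hy' (isOpen_lt continuous_const hτ) (isOpen_lt continuous_const hτ')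
    refine continuous_mk_stretch (x := fun p : M × unitInterval => x p.1)
      (y := fun p => y p.1) (τ := fun p => (1 - p.2) * τ p.1 + p.2 * τ' p.1) (by fun_prop) ?_ ?_
    · refine hxc.comp continuous_fst.continuousOn fun p hp => ?_
      have h0 := p.2.2.1
      have h1 := p.2.2.2
      by_contra! hc
      simp only [mem_union, mem_ofPred_eq, not_or, not_lt] at hc hp
      nlinarith [hc.1, hc.2]
    · refine hyc.comp continuous_fst.continuousOn fun p hp => ?_
      have h0 := p.2.2.1
      have h1 := p.2.2.2
      by_contra! hc
      simp only [mem_union, mem_ofPred_eq, not_or, not_lt] at hc hp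
      nlinarith [hc.1, hc.2]
  · simp
  · simp

lemma homot_self_stretch [Nonempty X] [Nonempty Y] {f : M → TopJoin X Y} (hf : Continuous f) :
    Homot f fun z =>
      mk (fstCoord (f z)) (sndCoord (f z)) (stretch (3 * height (f z) - 1)) := by
  let G : TopJoin X Y × unitInterval → TopJoin X Y := fun p =>
    mk (fstCoord p.1) (sndCoord p.1)
      (Set.projIcc 0 1 zero_le_one ((1 - p.2) * height p.1 + p.2 * stretch (3 * height p.1 - 1)))
  have hG : ∀ (x : X) (y : Y) (t s : unitInterval), G (mk x y t, s) =
      mk x y (Set.projIcc 0 1 zero_le_one ((1 - s) * t + s * stretch (3 * t - 1))) := by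
    intro x y t s
    simp only [G, height_mk]
    by_cases h1 : t = 1
    · have : sndCoord (mk x y t) = y := sndCoord_mk _ _ (by simp [h1])
      rw [this, h1, stretch_of_ge (by norm_num)]
      simp only [Set.Icc.coe_one, mul_one, sub_add_cancel, Set.projIcc_right]
      exact mk_one _ _ _
    have hx : fstCoord (mk x y t) = x := fstCoord_mk _ _ h1
    by_cases h0 : t = 0
    · rw [hx, h0, stretch_of_le (by norm_num)]
      simp only [Set.Icc.coe_zero, mul_zero, add_zero, Set.projIcc_left]
      exact mk_zero _ _ _
    · rw [hx, sndCoord_mk _ _ h0]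
  have hGc : Continuous G := by
    refine isQuotientMap_mk.continuous_lift_prod_left ?_
    simp only [hG]
    refine continuous_mk.comp (f := fun p : (X × Y × unitInterval) × unitInterval =>
      (p.1.1, p.1.2.1, Set.projIcc (0 : ℝ) 1 zero_le_one
        ((1 - p.2) * p.1.2.2 + p.2 * stretch (3 * p.1.2.2 - 1)))) ?_
    have : Continuous fun p : (X × Y × unitInterval) × unitInterval =>
        (stretch (3 * p.1.2.2 - 1) : ℝ) :=
      continuous_subtype_val.comp (continuous_stretch.comp (by fun_prop))
    have : Continuous fun p : (X × Y × unitInterval) × unitInterval =>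
        Set.projIcc (0 : ℝ) 1 zero_le_one
        ((1 - p.2) * p.1.2.2 + p.2 * stretch (3 * p.1.2.2 - 1)) :=
      continuous_projIcc.comp (by fun_prop)
    fun_prop
  refine ⟨fun p => G (f p.1, p.2), hGc.comp (by fun_prop), fun z => ?_, fun z => ?_⟩
  · obtain ⟨x, y, t, h⟩ := mk_surjective (f z)
    simp only [← h, hG]
    simp
  · simp [G]

lemma homot_const_of_continuous {x : M → X} {y : M → Y} {τ : M → ℝ} (hx : Continuous x)
    (hy : Continuous y) (hτ : Continuous τ) (x₀ : X) (y₀ : Y) :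
    Homot (fun z => mk (x z) (y z) (stretch (τ z))) fun _ => mk x₀ y₀ 1 := by
  have h0 : stretch 0 = 0 := stretch_of_le (by norm_num)
  have h1 : stretch 1 = 1 := stretch_of_ge (by norm_num)
  have e₁ : (fun z => mk (x z) (y z) (stretch 0)) = fun z => mk (x z) y₀ (stretch 0) := by
    funext z
    rw [h0]
    exact mk_zero _ _ _
  have e₂ : (fun z => mk (x z) y₀ (stretch 1)) = fun _ => mk x₀ y₀ 1 := by
    funext z
    rw [h1]
    exact mk_one _ _ _
  have a₁ := homot_height (τ := τ) (τ' := fun _ => 0) hτ continuous_const hx.continuousOn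
    hx.continuousOn hy.continuousOn hy.continuousOn
  have a₂ := homot_height (τ := fun _ : M => (0 : ℝ)) (τ' := fun _ => 1) (y := fun _ => y₀)
    continuous_const continuous_const hx.continuousOn
    hx.continuousOn continuousOn_const continuousOn_const
  exact (e₁ ▸ a₁).trans (e₂ ▸ a₂)

end TopJoin

open TopJoin in
lemma exists_ball_extension {Z : Type*} [TopologicalSpace Z] {k : ℕ}
    (f : C((Metric.sphere (0 : EuclideanSpace ℝ (Fin (k+1))) 1), Z)) {p : Z}
    (h : Homot f fun _ => p) :
    ∃ g : C((Metric.closedBall (0 : EuclideanSpace ℝ (Fin (k+1))) 1), Z),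
      ∀ z : (Metric.sphere (0 : EuclideanSpace ℝ (Fin (k+1))) 1),
        g ⟨z.1, Metric.sphere_subset_closedBall z.2⟩ = f z := by
  obtain ⟨H, hH, H0, H1⟩ := h
  let S := Metric.sphere (0 : EuclideanSpace ℝ (Fin (k+1))) 1
  let B := Metric.closedBall (0 : EuclideanSpace ℝ (Fin (k+1))) 1
  have hS : ∀ z : S, ‖z.1‖ = 1 := fun z => mem_sphere_zero_iff_norm.1 z.2
  let q : S × unitInterval → B := fun p => ⟨(1 - p.2 : ℝ) • p.1.1, by
    have h0 := p.2.2.1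
    have h1 := p.2.2.2
    simp only [B, mem_closedBall_zero_iff, norm_smul, hS, Real.norm_eq_abs, mul_one]
    rw [abs_le]
    constructor <;> linarith⟩
  have hq : Continuous q := by
    refine Continuous.subtype_mk ?_ _
    fun_prop
  have hsurj : Function.Surjective q := by
    rintro ⟨v, hv⟩
    have hv' : ‖v‖ ≤ 1 := by simpa [B] using hv
    by_cases h0 : v = 0
    · have : Nonempty S := by
        have := NormedSpace.sphere_nonempty (E := EuclideanSpace ℝ (Fin (k+1))) (x := 0) (r := 1)
        exact (this.2 zero_le_one).to_subtype
      refine ⟨(Classical.arbitrary S, 1), ?_⟩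
      simp [q, h0]
    · have hn : ‖v‖ ≠ 0 := norm_ne_zero_iff.2 h0
      refine ⟨(⟨‖v‖⁻¹ • v, by simp [S, norm_smul, hn]⟩,
        ⟨1 - ‖v‖, by linarith, by linarith [norm_nonneg v]⟩), ?_⟩
      simp [q, smul_smul, hn]
  have hqq : IsQuotientMap q := hq.isClosedMap.isQuotientMap hq hsurj
  let qc : C(S × unitInterval, B) := ⟨q, hq⟩
  have hfib : Function.FactorsThrough (⟨H, hH⟩ : C(S × unitInterval, Z)) qc := by
    rintro ⟨z, s⟩ ⟨w, t⟩ (hab : q (z, s) = q (w, t))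
    change H (z, s) = H (w, t)
    have e : (1 - s : ℝ) • z.1 = (1 - t : ℝ) • w.1 := congrArg Subtype.val hab
    have hn := congrArg norm e
    have hs := s.2.2
    have ht := t.2.2
    rw [norm_smul, norm_smul, hS, hS, Real.norm_of_nonneg (by linarith),
      Real.norm_of_nonneg (by linarith)] at hn
    have hst : s = t := Subtype.ext (by linarith)
    subst hst
    by_cases h1 : s = 1
    · rw [h1, H1, H1]
    · have : (1 - s : ℝ) ≠ 0 := fun h => h1 (Subtype.ext (sub_eq_zero.1 h).symm)
      rw [Subtype.ext (smul_right_injective _ this e)]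
  let g := IsQuotientMap.lift (f := qc) hqq ⟨H, hH⟩ hfib
  refine ⟨g, fun z => ?_⟩
  rw [← H0]
  have : (⟨z.1, Metric.sphere_subset_closedBall z.2⟩ : B) = q (z, 0) := by
    simp [q]
  rw [this]
  exact DFunLike.congr_fun (IsQuotientMap.lift_comp (f := qc) hqq ⟨H, hH⟩ hfib) (z, 0)

section Grid

variable {ι : Type*} [DecidableEq ι] {X : Type*} [TopologicalSpace X]

/-- The cell of the integer grid with lower corner `n` extending in the directions of `I`. -/
def gridCell (n : ι → ℤ) (I : Finset ι) : Set (ι → ℝ) :=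
  Set.Icc (fun i => (n i : ℝ)) fun i => n i + if i ∈ I then 1 else 0

/-- The relative boundary of a grid cell. -/
def gridBoundary (n : ι → ℤ) (I : Finset ι) : Set (ι → ℝ) :=
  {z ∈ gridCell n I | ∃ i ∈ I, z i = n i ∨ z i = n i + 1}

lemma mem_gridCell {n : ι → ℤ} {I : Finset ι} {z : ι → ℝ} :
    z ∈ gridCell n I ↔ ∀ i, (n i : ℝ) ≤ z i ∧ z i ≤ n i + if i ∈ I then 1 else 0 := by
  simp only [gridCell, Set.mem_Icc, Pi.le_def, forall_and]

lemma isCompact_gridCell (n : ι → ℤ) (I : Finset ι) : IsCompact (gridCell n I) :=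
  isCompact_Icc

lemma isClosed_gridBoundary (n : ι → ℤ) (I : Finset ι) : IsClosed (gridBoundary n I) := by
  have : gridBoundary n I =
      gridCell n I ∩ ⋃ i ∈ I, ({z | z i = n i} ∪ {z | z i = n i + 1}) := by
    ext z
    simp [gridBoundary]
  rw [this]
  refine (isCompact_gridCell n I).isClosed.inter (I.finite_toSet.isClosed_biUnion fun i _ => ?_)
  exact (isClosed_eq (continuous_apply i) continuous_const).union
    (isClosed_eq (continuous_apply i) continuous_const)

lemma eq_of_mem_gridCell {n : ι → ℤ} {I : Finset ι} {z : ι → ℝ} (hz : z ∈ gridCell n I) {i : ι}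
    (hi : i ∉ I) : z i = n i := by
  have := mem_gridCell.1 hz i
  simp only [hi, if_false, add_zero] at this
  exact le_antisymm this.2 this.1

/-- Extension over a cell of positive dimension `j + 1` using the sphere extension property. -/
lemma exists_extension_gridCell_of_sphereExt {n : ι → ℤ} {I : Finset ι} {j : ℕ}
    (hI : I.card = j + 1) (hX : SphereExt X j) {x : (ι → ℝ) → X}
    (hx : ContinuousOn x (gridBoundary n I)) :
    ∃ x' : (ι → ℝ) → X, ContinuousOn x' (gridCell n I) ∧ EqOn x' x (gridBoundary n I) := by
  let E := EuclideanSpace ℝ (Fin (j + 1))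
  let e : I ≃ Fin (j + 1) := I.equivFinOfCardEq hI
  let Q : Set (Fin (j + 1) → ℝ) := Set.univ.pi fun _ => Set.Icc 0 1
  let L : E ≃ₜ (Fin (j + 1) → ℝ) := (EuclideanSpace.equiv (Fin (j + 1)) ℝ).toHomeomorph
  let s : Set E := L ⁻¹' Q
  have hQc : IsCompact Q := isCompact_univ_pi fun _ => isCompact_Icc
  have hsc : IsCompact s := L.isCompact_preimage.2 hQc
  have hint : interior s = L ⁻¹' (Set.univ.pi fun _ => Set.Ioo 0 1) := by
    rw [← L.preimage_interior, interior_pi_set Set.finite_univ]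
    simp only [interior_Icc]
  have hconv : Convex ℝ s :=
    (convex_pi fun _ _ => convex_Icc (0 : ℝ) 1).linear_preimage
      (EuclideanSpace.equiv (Fin (j + 1)) ℝ).toLinearMap
  have hne : (interior s).Nonempty := by
    rw [hint]
    refine ⟨L.symm fun _ => 1 / 2, ?_⟩
    simp only [Set.mem_preimage, L.apply_symm_apply]
    intro i _
    norm_num
  obtain ⟨h, -, h2, h3⟩ :=
    exists_homeomorph_image_interior_closure_frontier_eq_unitBall hconv hne hsc.isBounded
  rw [hsc.isClosed.closure_eq] at h2
  have hfr : frontier s = s \ L ⁻¹' (Set.univ.pi fun _ => Set.Ioo 0 1) := by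
    rw [hsc.isClosed.frontier_eq, hint]
  let φ : E → ι → ℝ := fun v i => n i + if hi : i ∈ I then L v (e ⟨i, hi⟩) else 0
  let ψ : (ι → ℝ) → E := fun z => L.symm fun a => z (e.symm a) - n (e.symm a)
  have hφ : Continuous φ := by
    refine continuous_pi fun i => ?_
    by_cases hi : i ∈ I
    · simp only [φ, hi, dif_pos]
      have := (continuous_apply (e ⟨i, hi⟩)).comp L.continuous
      exact continuous_const.add this
    · simp only [φ, hi, dif_neg, not_false_iff]
      exact continuous_const
  have hψ : Continuous ψ := by
    refine L.symm.continuous.comp ?_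
    fun_prop
  have hφe : ∀ v a, φ v (e.symm a) = n (e.symm a) + L v a := by
    intro v a
    simp [φ]
  have hφs : ∀ v ∈ frontier s, φ v ∈ gridBoundary n I := by
    intro v hv
    rw [hfr] at hv
    obtain ⟨hv, hv'⟩ := hv
    have hv1 : ∀ a, 0 ≤ L v a ∧ L v a ≤ 1 := fun a => hv a trivial
    refine ⟨mem_gridCell.2 fun i => ?_, ?_⟩
    · by_cases hi : i ∈ I
      · simpa [φ, hi] using hv1 _
      · simp [φ, hi]
    · simp only [Set.mem_preimage, Set.mem_pi, Set.mem_univ, true_imp_iff, not_forall] at hv'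
      obtain ⟨a, ha⟩ := hv'
      refine ⟨(e.symm a).1, (e.symm a).2, ?_⟩
      rw [hφe]
      by_cases h0 : L v a = 0
      · left
        rw [h0, add_zero]
      · right
        have h0' := lt_of_le_of_ne (hv1 a).1 (Ne.symm h0)
        have h1 := not_lt.1 fun hlt => ha ⟨h0', hlt⟩
        rw [le_antisymm (hv1 a).2 h1]
  have hψs : ∀ z ∈ gridCell n I, ψ z ∈ s := by
    intro z hz a _
    have := mem_gridCell.1 hz (e.symm a)
    rw [if_pos (e.symm a).2] at this
    simp only [ψ, L.apply_symm_apply, Set.mem_Icc]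
    constructor <;> linarith
  have hψf : ∀ z ∈ gridBoundary n I, ψ z ∈ frontier s := by
    intro z hz
    rw [hfr]
    refine ⟨hψs z hz.1, fun hc => ?_⟩
    obtain ⟨i, hi, h⟩ := hz.2
    have := hc (e ⟨i, hi⟩) trivial
    simp only [ψ, L.apply_symm_apply, Set.mem_Ioo, Equiv.symm_apply_apply] at this
    rcases h with h | h <;> linarith
  have hφψ : ∀ z ∈ gridCell n I, φ (ψ z) = z := by
    intro z hz
    funext i
    by_cases hi : i ∈ I
    · simp [φ, ψ, hi, L]
    · simp [φ, hi, eq_of_mem_gridCell hz hi]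
  have hsymm : ∀ v ∈ Metric.sphere (0 : E) 1, h.symm v ∈ frontier s := by
    intro v hv
    rw [← h3] at hv
    obtain ⟨w, hw, rfl⟩ := hv
    simpa using hw
  let f : C(Metric.sphere (0 : E) 1, X) :=
    ⟨fun v => x (φ (h.symm v)), by
      refine hx.comp_continuous (hφ.comp (h.symm.continuous.comp continuous_subtype_val)) ?_
      exact fun v => hφs _ (hsymm _ v.2)⟩
  obtain ⟨g, hg⟩ := hX f
  have hmem : ∀ z ∈ gridCell n I, h (ψ z) ∈ Metric.closedBall (0 : E) 1 := by
    intro z hz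
    rw [← h2]
    exact Set.mem_image_of_mem _ (hψs z hz)
  classical
  let p₀ : Metric.closedBall (0 : E) 1 := ⟨0, by simp⟩
  refine ⟨fun z => if hz : h (ψ z) ∈ Metric.closedBall (0 : E) 1 then g ⟨_, hz⟩ else g p₀, ?_, ?_⟩
  · rw [continuousOn_iff_continuous_domRestrict]
    have : Continuous fun z : gridCell n I => g ⟨h (ψ z), hmem z z.2⟩ :=
      g.continuous.comp ((h.continuous.comp (hψ.comp continuous_subtype_val)).subtype_mk _)
    refine this.congr fun z => ?_
    simp only [Set.domRestrict_apply]
    rw [dif_pos (hmem z z.2)]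
  · intro z hz
    have hs : h (ψ z) ∈ Metric.sphere (0 : E) 1 := by
      rw [← h3]
      exact Set.mem_image_of_mem _ (hψf z hz)
    simp only
    rw [dif_pos (hmem z hz.1)]
    have := hg ⟨_, hs⟩
    rw [this]
    simp only [f, ContinuousMap.coe_mk, h.symm_apply_apply]
    rw [hφψ z hz.1]

section Radial

variable {γ : ℝ}

/-- The point of a cell whose free coordinates are offset by `γ` from the lower corner. -/
def cellPoint (γ : ℝ) (n : ι → ℤ) (I : Finset ι) : ι → ℝ :=
  fun i => n i + if i ∈ I then γ else 0

variable [Fintype ι]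

/-- The gauge of a grid cell centred at `cellPoint γ n I`. -/
def cellGauge (γ : ℝ) (n : ι → ℤ) (I : Finset ι) (z : ι → ℝ) : ℝ :=
  ‖fun i => max ((z i - cellPoint γ n I i) / (1 - γ)) (-(z i - cellPoint γ n I i) / γ)‖

/-- Radial projection from `cellPoint γ n I` to the boundary of the cell. -/
def cellProj (γ : ℝ) (n : ι → ℤ) (I : Finset ι) (z : ι → ℝ) : ι → ℝ :=
  cellPoint γ n I + (cellGauge γ n I z)⁻¹ • (z - cellPoint γ n I)

lemma continuous_cellGauge (γ : ℝ) (n : ι → ℤ) (I : Finset ι) :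
    Continuous (cellGauge γ n I) := by
  unfold cellGauge
  fun_prop

lemma le_cellGauge (hγ : 0 < γ) (hγ' : γ < 1) (n : ι → ℤ) (I : Finset ι) (z : ι → ℝ) (i : ι) :
    z i - cellPoint γ n I i ≤ cellGauge γ n I z * (1 - γ) ∧
      -(z i - cellPoint γ n I i) ≤ cellGauge γ n I z * γ := by
  have h := (le_abs_self _).trans (norm_le_pi_norm (fun i =>
    max ((z i - cellPoint γ n I i) / (1 - γ)) (-(z i - cellPoint γ n I i) / γ)) i)
  rw [max_le_iff, div_le_iff₀ (by linarith), div_le_iff₀ hγ] at h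
  exact h

lemma exists_eq_cellGauge (hγ : 0 < γ) (hγ' : γ < 1) (n : ι → ℤ) (I : Finset ι) (z : ι → ℝ)
    [Nonempty ι] : ∃ i, z i - cellPoint γ n I i = cellGauge γ n I z * (1 - γ) ∨
      -(z i - cellPoint γ n I i) = cellGauge γ n I z * γ := by
  set w : ι → ℝ := fun i =>
    max ((z i - cellPoint γ n I i) / (1 - γ)) (-(z i - cellPoint γ n I i) / γ) with hw
  have h1 : (0 : ℝ) < 1 - γ := by linarith
  have hw0 : ∀ i, 0 ≤ w i := by
    intro i
    rcases le_total 0 (z i - cellPoint γ n I i) with h | h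
    · exact le_max_of_le_left (div_nonneg h h1.le)
    · exact le_max_of_le_right (div_nonneg (by linarith) hγ.le)
  obtain ⟨i, hi⟩ : ∃ i, w i = ‖w‖ := by
    obtain ⟨i, -, hi⟩ := Finset.exists_max_image Finset.univ w Finset.univ_nonempty
    refine ⟨i, le_antisymm ((le_abs_self _).trans (norm_le_pi_norm w i)) ?_⟩
    refine (pi_norm_le_iff_of_nonneg (hw0 i)).2 fun k => ?_
    rw [Real.norm_of_nonneg (hw0 k)]
    exact hi k (Finset.mem_univ k)
  refine ⟨i, ?_⟩
  change _ = ‖w‖ * _ ∨ _ = ‖w‖ * _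
  rw [← hi]
  rcases max_choice ((z i - cellPoint γ n I i) / (1 - γ)) (-(z i - cellPoint γ n I i) / γ)
    with h | h
  · left
    simp only [hw, h]
    field_simp
  · right
    simp only [hw, h]
    field_simp

lemma cellGauge_pos (hγ : 0 < γ) (hγ' : γ < 1) {n : ι → ℤ} {I : Finset ι} {z : ι → ℝ}
    (hz : z ≠ cellPoint γ n I) : 0 < cellGauge γ n I z := by
  refine lt_of_le_of_ne (norm_nonneg _) fun h => hz ?_
  funext i
  have := le_cellGauge hγ hγ' n I z i
  rw [show cellGauge γ n I z = 0 from h.symm] at this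
  linarith [this.1, this.2]

lemma cellGauge_le_one (hγ : 0 < γ) (hγ' : γ < 1) {n : ι → ℤ} {I : Finset ι} {z : ι → ℝ}
    (hz : z ∈ gridCell n I) : cellGauge γ n I z ≤ 1 := by
  refine (pi_norm_le_iff_of_nonneg zero_le_one).2 fun i => ?_
  have h1 : (0 : ℝ) < 1 - γ := by linarith
  have := mem_gridCell.1 hz i
  rw [Real.norm_eq_abs, abs_le]
  constructor
  · refine le_trans (neg_nonpos.2 zero_le_one) ?_
    rcases le_total 0 (z i - cellPoint γ n I i) with h | h
    · exact le_max_of_le_left (div_nonneg h h1.le)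
    · exact le_max_of_le_right (div_nonneg (by linarith) hγ.le)
  · rw [max_le_iff, div_le_iff₀ h1, div_le_iff₀ hγ]
    by_cases hi : i ∈ I
    · simp only [hi, if_true, cellPoint] at this ⊢
      constructor <;> linarith
    · simp only [hi, if_false, cellPoint] at this ⊢
      constructor <;> linarith

lemma cellProj_mem (hγ : 0 < γ) (hγ' : γ < 1) {n : ι → ℤ} {I : Finset ι} {z : ι → ℝ}
    (hz : z ∈ gridCell n I) (hzc : z ≠ cellPoint γ n I) :
    cellProj γ n I z ∈ gridBoundary n I := by
  have hpos := cellGauge_pos hγ hγ' hzc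
  have hle : ∀ i, (cellGauge γ n I z)⁻¹ * (z i - cellPoint γ n I i) ≤ 1 - γ ∧
      -γ ≤ (cellGauge γ n I z)⁻¹ * (z i - cellPoint γ n I i) := by
    intro i
    have := le_cellGauge hγ hγ' n I z i
    rw [inv_mul_le_iff₀ hpos, le_inv_mul_iff₀ hpos]
    constructor <;> linarith
  have hne : Nonempty ι := by
    by_contra h
    rw [not_nonempty_iff] at h
    exact hzc (Subsingleton.elim _ _)
  have hoff : ∀ i ∉ I, z i - cellPoint γ n I i = 0 := by
    intro i hi
    simp [cellPoint, hi, eq_of_mem_gridCell hz hi]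
  refine ⟨mem_gridCell.2 fun i => ?_, ?_⟩
  · simp only [cellProj, Pi.add_apply, Pi.smul_apply, Pi.sub_apply, smul_eq_mul]
    by_cases hi : i ∈ I
    · have := hle i
      simp only [cellPoint, hi, if_true] at this ⊢
      constructor <;> linarith
    · rw [hoff i hi]
      simp [cellPoint, hi]
  · obtain ⟨i, hi⟩ := exists_eq_cellGauge hγ hγ' n I z
    have hiI : i ∈ I := by
      by_contra hc
      rw [hoff i hc] at hi
      have := mul_pos hpos hγ
      have := mul_pos hpos (sub_pos.2 hγ')
      rcases hi with h | h <;> linarith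
    refine ⟨i, hiI, ?_⟩
    simp only [cellProj, Pi.add_apply, Pi.smul_apply, Pi.sub_apply, smul_eq_mul]
    rcases hi with h | h
    · right
      rw [h, inv_mul_cancel_left₀ hpos.ne']
      simp [cellPoint, hiI]
    · left
      rw [show z i - cellPoint γ n I i = -(cellGauge γ n I z * γ) by linarith, mul_neg,
        inv_mul_cancel_left₀ hpos.ne']
      simp [cellPoint, hiI]

lemma eq_cellPoint_add_smul (hγ : 0 < γ) (hγ' : γ < 1) {n : ι → ℤ} {I : Finset ι} {z : ι → ℝ}
    (hzc : z ≠ cellPoint γ n I) :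
    z = cellPoint γ n I + cellGauge γ n I z • (cellProj γ n I z - cellPoint γ n I) := by
  rw [cellProj, add_sub_cancel_left, smul_inv_smul₀ (cellGauge_pos hγ hγ' hzc).ne',
    add_sub_cancel]

lemma cellProj_eq_self (hγ : 0 < γ) (hγ' : γ < 1) {n : ι → ℤ} {I : Finset ι} {z : ι → ℝ}
    (hz : z ∈ gridBoundary n I) : cellProj γ n I z = z := by
  have : cellGauge γ n I z = 1 := by
    refine le_antisymm (cellGauge_le_one hγ hγ' hz.1) ?_
    obtain ⟨i, hi, h⟩ := hz.2
    have hle := le_cellGauge hγ hγ' n I z i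
    simp only [cellPoint, hi, if_true] at hle
    rcases h with h | h
    · refine le_of_mul_le_mul_right ?_ hγ
      linarith [hle.2]
    · refine le_of_mul_le_mul_right ?_ (sub_pos.2 hγ')
      linarith [hle.1]
  rw [cellProj, this, inv_one, one_smul, add_sub_cancel]

lemma continuousOn_cellProj (hγ : 0 < γ) (hγ' : γ < 1) (n : ι → ℤ) (I : Finset ι) :
    ContinuousOn (cellProj γ n I) {cellPoint γ n I}ᶜ := by
  unfold cellProj
  have hsub : Continuous fun z : ι → ℝ => z - cellPoint γ n I := by fun_prop
  refine continuousOn_const.add (ContinuousOn.fun_smul ?_ hsub.continuousOn)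
  exact (continuous_cellGauge γ n I).continuousOn.inv₀ fun z hz => (cellGauge_pos hγ hγ' hz).ne'

end Radial

lemma continuousOn_union_diff {α β : Type*} [TopologicalSpace α] [TopologicalSpace β] {f : α → β}
    {K W S : Set α} (hK : IsClosed K) (hW : IsClosed W) (hfK : ContinuousOn f (K \ S))
    (hfW : ContinuousOn f (W \ S)) : ContinuousOn f ((K ∪ W) \ S) := by
  intro z hz
  rw [Set.union_sdiff_distrib, continuousWithinAt_union]
  constructor
  · by_cases h : z ∈ K
    · exact hfK z ⟨h, hz.2⟩
    · exact continuousWithinAt_of_notMem_closure fun hc =>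
        h (hK.closure_subset_iff.2 Set.sdiff_subset hc)
  · by_cases h : z ∈ W
    · exact hfW z ⟨h, hz.2⟩
    · exact continuousWithinAt_of_notMem_closure fun hc =>
        h (hW.closure_subset_iff.2 Set.sdiff_subset hc)

section Extension

variable [Fintype ι]

/-- The number of coordinates of `z` whose fractional part lies in `(lo, hi)`. -/
def fractCount (lo hi : ℝ) (z : ι → ℝ) : ℕ :=
  (Finset.univ.filter fun i => lo < Int.fract (z i) ∧ Int.fract (z i) < hi).card

omit [DecidableEq ι] in
lemma fractCount_mono {lo hi : ℝ} {z w : ι → ℝ}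
    (h : ∀ i, lo < Int.fract (z i) → Int.fract (z i) < hi →
      lo < Int.fract (w i) ∧ Int.fract (w i) < hi) : fractCount lo hi z ≤ fractCount lo hi w := by
  refine Finset.card_le_card fun i hi => ?_
  simp only [Finset.mem_filter, Finset.mem_univ, true_and] at hi ⊢
  exact h i hi.1 hi.2

lemma fractCount_le_card {lo hi : ℝ} (hlo : 0 ≤ lo) {n : ι → ℤ} {I : Finset ι} {z : ι → ℝ}
    (hz : z ∈ gridCell n I) : fractCount lo hi z ≤ I.card := by
  refine Finset.card_le_card fun i hi => ?_
  simp only [Finset.mem_filter, Finset.mem_univ, true_and] at hi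
  by_contra hiI
  rw [eq_of_mem_gridCell hz hiI, Int.fract_intCast] at hi
  linarith [hi.1]

omit [Fintype ι] in
lemma fract_cellPoint {γ : ℝ} (hγ : 0 < γ) (hγ' : γ < 1) (n : ι → ℤ) {I : Finset ι} {i : ι}
    (hi : i ∈ I) : Int.fract (cellPoint γ n I i) = γ := by
  simp only [cellPoint, hi, if_true, Int.fract_intCast_add]
  exact Int.fract_eq_self.2 ⟨hγ.le, hγ'⟩

/-- Moving from a point of a cell towards `cellPoint γ n I` does not decrease `fractCount`. -/
lemma fractCount_le_of_segment {lo hi γ : ℝ} (hlo : 0 ≤ lo) (hγ : lo < γ) (hγ' : γ < hi)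
    (hhi : hi ≤ 1) {n : ι → ℤ} {I : Finset ι} {z : ι → ℝ} (hz : z ∈ gridCell n I) {r : ℝ}
    (hr : 0 ≤ r) (hr' : r ≤ 1) :
    fractCount lo hi z ≤ fractCount lo hi (cellPoint γ n I + r • (z - cellPoint γ n I)) := by
  refine fractCount_mono fun i h h' => ?_
  have hiI : i ∈ I := by
    by_contra hiI
    rw [eq_of_mem_gridCell hz hiI, Int.fract_intCast] at h
    linarith
  have hzi := mem_gridCell.1 hz i
  simp only [hiI, if_true] at hzi
  have hlt : z i < n i + 1 := by
    refine lt_of_le_of_ne hzi.2 fun he => ?_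
    rw [he, Int.fract_add_one, Int.fract_intCast] at h
    linarith
  have hfl : ⌊z i⌋ = n i := Int.floor_eq_iff.2 ⟨hzi.1, hlt⟩
  have hfr : Int.fract (z i) = z i - n i := by rw [Int.fract, hfl]
  rw [hfr] at h h'
  have hval : (cellPoint γ n I + r • (z - cellPoint γ n I)) i =
      n i + (γ + r * (z i - n i - γ)) := by
    simp only [Pi.add_apply, Pi.smul_apply, Pi.sub_apply, smul_eq_mul, cellPoint, hiI, if_true]
    ring
  rw [hval, Int.fract_intCast_add]
  obtain ⟨h1, h2⟩ : γ + r * (z i - n i - γ) ∈ Set.Ioo lo hi :=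
    (convex_Ioo lo hi).add_smul_sub_mem ⟨hγ, hγ'⟩ ⟨h, h'⟩ ⟨hr, hr'⟩
  rw [Int.fract_eq_self.2 ⟨by linarith, by linarith⟩]
  exact ⟨h1, h2⟩

/-- Extend a partial map over one more cell, either fully (when the cell has small dimension) or
away from a cone of points having many fractional parts in `(lo, hi)`. -/
lemma exists_extension_gridCell [Nonempty X] {p : ℕ}
    (hX : ∀ j, j + 1 < p → SphereExt X j) {lo hi γ : ℝ} (hlo : 0 ≤ lo) (hγ : lo < γ)
    (hγ' : γ < hi) (hhi : hi ≤ 1) {n : ι → ℤ} {I : Finset ι} {K S : Set (ι → ℝ)}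
    (hK : IsClosed K) (hKn : K ∩ gridCell n I ⊆ gridBoundary n I) (hnK : gridBoundary n I ⊆ K)
    (hS : IsClosed S) (hSp : ∀ z ∈ S, p ≤ fractCount lo hi z) {x : (ι → ℝ) → X}
    (hx : ContinuousOn x (K \ S)) :
    ∃ (x' : (ι → ℝ) → X) (S' : Set (ι → ℝ)), IsClosed S' ∧ S ⊆ S' ∧ S' ⊆ S ∪ gridCell n I ∧
      (∀ z ∈ S', p ≤ fractCount lo hi z) ∧ EqOn x' x K ∧
      ContinuousOn x' ((K ∪ gridCell n I) \ S') := by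
  have hγ0 : 0 < γ := by linarith
  have hγ1 : γ < 1 := by linarith
  suffices H : ∃ (x' : (ι → ℝ) → X) (S' : Set (ι → ℝ)), IsClosed S' ∧ S ⊆ S' ∧
      S' ⊆ S ∪ gridCell n I ∧ (∀ z ∈ S', p ≤ fractCount lo hi z) ∧
      EqOn x' x (gridBoundary n I) ∧ ContinuousOn x' (gridCell n I \ S') by
    obtain ⟨x', S', h1, h2, h3, h4, h5, h6⟩ := H
    classical
    refine ⟨fun z => if z ∈ K then x z else x' z, S', h1, h2, h3, h4, fun z hz => if_pos hz, ?_⟩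
    refine continuousOn_union_diff hK (isCompact_gridCell n I).isClosed ?_ ?_
    · exact (hx.mono (Set.sdiff_subset_sdiff_right h2)).congr fun z hz => if_pos hz.1
    · refine h6.congr fun z hz => ?_
      by_cases hzK : z ∈ K
      · simp only [hzK, if_true]
        exact (h5 (hKn ⟨hzK, hz.1⟩)).symm
      · simp only [hzK, if_false]
  rcases lt_or_ge I.card p with hcard | hcard
  · have hSW : ∀ z ∈ gridCell n I, z ∉ S := fun z hz hzS =>
      absurd (fractCount_le_card (hi := hi) hlo hz) (by have := hSp z hzS; omega)
    have hxb : ContinuousOn x (gridBoundary n I) := hx.mono fun z hz => ⟨hnK hz, hSW z hz.1⟩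
    obtain ⟨x', h1, h2⟩ : ∃ x' : (ι → ℝ) → X, ContinuousOn x' (gridCell n I) ∧
        EqOn x' x (gridBoundary n I) := by
      rcases hc : I.card with - | j
      · rw [Finset.card_eq_zero] at hc
        refine ⟨fun _ => Classical.arbitrary X, continuousOn_const, fun z hz => ?_⟩
        obtain ⟨i, hi, -⟩ := hz.2
        simp [hc] at hi
      · exact exists_extension_gridCell_of_sphereExt hc (hX j (by omega)) hxb
    exact ⟨x', S, hS, subset_rfl, subset_union_left, hSp, h2, h1.mono Set.sdiff_subset⟩
  · let C : Set (ι → ℝ) := (fun q : ℝ × (ι → ℝ) =>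
      cellPoint γ n I + q.1 • (q.2 - cellPoint γ n I)) '' (Set.Icc 0 1 ×ˢ (S ∩ gridBoundary n I))
    have hCc : IsCompact C := by
      refine (isCompact_Icc.prod ?_).image (by fun_prop)
      exact (isCompact_gridCell n I).of_isClosed_subset (hS.inter (isClosed_gridBoundary n I))
        fun z hz => hz.2.1
    have hcell : cellPoint γ n I ∈ gridCell n I := by
      refine mem_gridCell.2 fun i => ?_
      by_cases hi : i ∈ I <;> simp [cellPoint, hi, hγ0.le, hγ1.le]
    refine ⟨fun z => x (cellProj γ n I z), S ∪ ({cellPoint γ n I} ∪ C), ?_, subset_union_left,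
      ?_, ?_, ?_, ?_⟩
    · exact hS.union (isClosed_singleton.union hCc.isClosed)
    · refine Set.union_subset_union_right _ (Set.union_subset (by simpa using hcell) ?_)
      rintro _ ⟨⟨r, z⟩, ⟨hr, hz⟩, rfl⟩
      exact (convex_Icc _ _).add_smul_sub_mem hcell hz.2.1 hr
    · rintro z (hz | hz | hz)
      · exact hSp z hz
      · rw [Set.mem_singleton_iff.1 hz]
        refine hcard.trans (Finset.card_le_card fun i hi => ?_)
        simp [fract_cellPoint hγ0 hγ1 n hi, hγ, hγ']
      · obtain ⟨⟨r, z⟩, ⟨hr, hz⟩, rfl⟩ := hz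
        exact (hSp z hz.1).trans
          (fractCount_le_of_segment hlo hγ hγ' hhi hz.2.1 hr.1 hr.2)
    · intro z hz
      simp only [cellProj_eq_self hγ0 hγ1 hz]
    · refine hx.comp ((continuousOn_cellProj hγ0 hγ1 n I).mono ?_) ?_
      · rintro z hz rfl
        exact hz.2 (Or.inr (Or.inl rfl))
      · intro z hz
        have hzc : z ≠ cellPoint γ n I := by
          rintro rfl
          exact hz.2 (Or.inr (Or.inl rfl))
        have hb := cellProj_mem hγ0 hγ1 hz.1 hzc
        refine ⟨hnK hb, fun hpS => hz.2 (Or.inr (Or.inr ?_))⟩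
        exact ⟨(cellGauge γ n I z, cellProj γ n I z), ⟨⟨(cellGauge_pos hγ0 hγ1 hzc).le,
          cellGauge_le_one hγ0 hγ1 hz.1⟩, hpS, hb⟩, (eq_cellPoint_add_smul hγ0 hγ1 hzc).symm⟩

end Extension

section Induction

variable [Fintype ι]

omit [Fintype ι] in
lemma subset_of_gridCell_subset {n n' : ι → ℤ} {I I' : Finset ι}
    (h : gridCell n I ⊆ gridCell n' I') : I ⊆ I' ∧ (I = I' → n = n') := by
  have h1 : (fun i => (n i : ℝ)) ∈ gridCell n' I' := h <| mem_gridCell.2 fun i => by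
    refine ⟨le_rfl, ?_⟩
    split_ifs <;> simp
  have h2 : (fun i => (n i : ℝ) + if i ∈ I then 1 else 0) ∈ gridCell n' I' :=
    h <| mem_gridCell.2 fun i => by
      refine ⟨?_, le_rfl⟩
      split_ifs <;> simp
  rw [mem_gridCell] at h1 h2
  refine ⟨fun i hi => ?_, ?_⟩
  · by_contra hi'
    have h1i := h1 i
    have h2i := h2 i
    simp only [hi, hi', if_true, if_false] at h1i h2i
    linarith
  · rintro rfl
    funext i
    have h1i := h1 i
    have h2i := h2 i
    have h3 : n' i ≤ n i := by exact_mod_cast h1i.1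
    have h4 : n i ≤ n' i := by
      have : (n i : ℝ) ≤ n' i := by linarith
      exact_mod_cast this
    exact le_antisymm h4 h3

omit [Fintype ι] in
lemma gridCell_subset_of_mem {n n' : ι → ℤ} {I I' : Finset ι} {z : ι → ℝ}
    (hz : z ∈ gridCell n I) (hzb : z ∉ gridBoundary n I) (hz' : z ∈ gridCell n' I') :
    gridCell n I ⊆ gridCell n' I' := by
  have key : ∀ i, n' i ≤ n i ∧ n i + (if i ∈ I then 1 else 0) ≤ n' i + if i ∈ I' then 1 else 0 := by
    intro i
    have h1 := mem_gridCell.1 hz i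
    have h2 := mem_gridCell.1 hz' i
    by_cases hi : i ∈ I
    · simp only [hi, if_true] at h1 ⊢
      have hl : (n i : ℝ) < z i := lt_of_le_of_ne h1.1 fun h => hzb ⟨hz, i, hi, Or.inl h.symm⟩
      have hr : z i < n i + 1 := lt_of_le_of_ne h1.2 fun h => hzb ⟨hz, i, hi, Or.inr h⟩
      have h3 : n' i < n i + 1 := by
        have : (n' i : ℝ) < n i + 1 := by linarith
        exact_mod_cast this
      have h4 : n i < n' i + if i ∈ I' then 1 else 0 := by
        have : (n i : ℝ) < n' i + if i ∈ I' then 1 else 0 := by linarith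
        split_ifs at this ⊢ <;> exact_mod_cast this
      omega
    · simp only [hi, if_false, add_zero] at h1 ⊢
      rw [le_antisymm h1.2 h1.1] at h2
      refine ⟨by exact_mod_cast h2.1, ?_⟩
      have := h2.2
      split_ifs at this ⊢ <;> exact_mod_cast this
  intro w hw
  refine mem_gridCell.2 fun i => ?_
  have h1 := mem_gridCell.1 hw i
  have h2 : (n' i : ℝ) ≤ n i := by exact_mod_cast (key i).1
  have h3 : (n i : ℝ) + (if i ∈ I then 1 else 0) ≤ n' i + if i ∈ I' then 1 else 0 := by
    have := (key i).2
    split_ifs at this ⊢ <;> exact_mod_cast this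
  exact ⟨h2.trans h1.1, h1.2.trans h3⟩

omit [Fintype ι] in
lemma exists_face_of_mem_gridBoundary {n : ι → ℤ} {I : Finset ι} {z : ι → ℝ}
    (hz : z ∈ gridBoundary n I) : ∃ n' I', z ∈ gridCell n' I' ∧ gridCell n' I' ⊆ gridCell n I ∧
      I'.card < I.card := by
  obtain ⟨hz, i, hi, h⟩ := hz
  obtain ⟨a, hza, ha⟩ : ∃ a : ℤ, z i = a ∧ (a = n i ∨ a = n i + 1) := by
    rcases h with h | h
    · exact ⟨n i, h, Or.inl rfl⟩
    · exact ⟨n i + 1, by simpa using h, Or.inr rfl⟩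
  refine ⟨Function.update n i a, I.erase i, mem_gridCell.2 fun k => ?_, fun w hw => ?_,
    Finset.card_erase_lt_of_mem hi⟩
  · by_cases hk : k = i
    · subst hk
      simp [hza]
    · simpa [hk] using mem_gridCell.1 hz k
  · refine mem_gridCell.2 fun k => ?_
    have hwk := mem_gridCell.1 hw k
    by_cases hk : k = i
    · subst hk
      simp only [Function.update_self, Finset.mem_erase, ne_eq, not_true_eq_false, false_and,
        if_false, add_zero, hi, if_true] at hwk ⊢
      rcases ha with rfl | rfl
      · constructor <;> linarith
      · push_cast at hwk
        constructor <;> linarith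
    · simpa [hk] using hwk

/-- A family of grid cells that contains all faces of its members. -/
def FaceClosed (𝒞 : Finset ((ι → ℤ) × Finset ι)) : Prop :=
  ∀ c ∈ 𝒞, ∀ n I, gridCell n I ⊆ gridCell c.1 c.2 → (n, I) ∈ 𝒞

/-- Extend a map from a subcomplex of the grid to a larger one, away from a closed set of points
having many fractional parts in `(lo, hi)`. -/
lemma exists_extension_complex [Nonempty X] {p : ℕ} (hX : ∀ j, j + 1 < p → SphereExt X j)
    {lo hi γ : ℝ} (hlo : 0 ≤ lo) (hγ : lo < γ) (hγ' : γ < hi) (hhi : hi ≤ 1)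
    {𝒞 : Finset ((ι → ℤ) × Finset ι)} (h𝒞 : FaceClosed 𝒞) (𝒢 : Finset ((ι → ℤ) × Finset ι))
    (h𝒢 : FaceClosed 𝒢) (h𝒢𝒞 : 𝒢 ⊆ 𝒞) {S : Set (ι → ℝ)} (hS : IsClosed S)
    (hSp : ∀ z ∈ S, p ≤ fractCount lo hi z) {x : (ι → ℝ) → X}
    (hx : ContinuousOn x ((⋃ c ∈ 𝒢, gridCell c.1 c.2) \ S)) :
    ∃ (x' : (ι → ℝ) → X) (S' : Set (ι → ℝ)), IsClosed S' ∧
      S' ⊆ S ∪ ⋃ c ∈ 𝒞 \ 𝒢, gridCell c.1 c.2 ∧ (∀ z ∈ S', p ≤ fractCount lo hi z) ∧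
      EqOn x' x (⋃ c ∈ 𝒢, gridCell c.1 c.2) ∧
      ContinuousOn x' ((⋃ c ∈ 𝒞, gridCell c.1 c.2) \ S') := by
  induction hN : (𝒞 \ 𝒢).card using Nat.strong_induction_on generalizing 𝒢 S x with
  | _ N ih =>
    rcases (𝒞 \ 𝒢).eq_empty_or_nonempty with he | hne
    · have : 𝒢 = 𝒞 := h𝒢𝒞.antisymm (Finset.sdiff_eq_empty_iff_subset.1 he)
      subst this
      exact ⟨x, S, hS, subset_union_left, hSp, fun _ _ => rfl, hx⟩
    obtain ⟨W, hW, hmin⟩ := Finset.exists_min_image (𝒞 \ 𝒢) (fun c => c.2.card) hne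
    rw [Finset.mem_sdiff] at hW
    have hsmall : ∀ n I, gridCell n I ⊆ gridCell W.1 W.2 → I.card < W.2.card → (n, I) ∈ 𝒢 := by
      intro n I hs hc
      by_contra hn
      exact absurd (hmin (n, I) (Finset.mem_sdiff.2 ⟨h𝒞 W hW.1 n I hs, hn⟩)) (not_le.2 hc)
    have h𝒢' : FaceClosed (insert W 𝒢) := by
      intro c hc n I hs
      rcases Finset.mem_insert.1 hc with rfl | hc
      · obtain ⟨h1, h2⟩ := subset_of_gridCell_subset hs
        rcases h1.eq_or_ssubset with h | h
        · rw [h, h2 h]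
          exact Finset.mem_insert_self _ _
        · exact Finset.mem_insert_of_mem (hsmall n I hs (Finset.card_lt_card h))
      · exact Finset.mem_insert_of_mem (h𝒢 c hc n I hs)
    obtain ⟨x₁, S₁, hS₁, -, hsub₁, hSp₁, heq₁, hx₁⟩ := exists_extension_gridCell hX hlo hγ hγ' hhi
      (n := W.1) (I := W.2) (K := ⋃ c ∈ 𝒢, gridCell c.1 c.2)
      (𝒢.finite_toSet.isClosed_biUnion fun c _ => (isCompact_gridCell c.1 c.2).isClosed)
      (by
        rintro z ⟨hz, hzW⟩
        by_contra hzb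
        simp only [mem_iUnion] at hz
        obtain ⟨c, hc, hz⟩ := hz
        exact hW.2 (h𝒢 c hc W.1 W.2 (gridCell_subset_of_mem hzW hzb hz)))
      (by
        intro z hz
        obtain ⟨n', I', h1, h2, h3⟩ := exists_face_of_mem_gridBoundary hz
        simp only [mem_iUnion]
        exact ⟨(n', I'), hsmall n' I' h2 h3, h1⟩)
      hS hSp hx
    have hunion : (⋃ c ∈ insert W 𝒢, gridCell c.1 c.2) =
        (⋃ c ∈ 𝒢, gridCell c.1 c.2) ∪ gridCell W.1 W.2 := by
      rw [Finset.set_biUnion_insert, union_comm]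
    have hsdiff : 𝒞 \ insert W 𝒢 ⊂ 𝒞 \ 𝒢 := by
      refine Finset.ssubset_iff_subset_ne.2
        ⟨Finset.sdiff_subset_sdiff subset_rfl (Finset.subset_insert _ _), fun h => ?_⟩
      have : W ∈ 𝒞 \ insert W 𝒢 := h ▸ Finset.mem_sdiff.2 hW
      simp at this
    obtain ⟨x₂, S₂, hS₂, hsub₂, hSp₂, heq₂, hx₂⟩ := ih _ (hN ▸ Finset.card_lt_card hsdiff)
      (insert W 𝒢) h𝒢' (Finset.insert_subset hW.1 h𝒢𝒞) hS₁ hSp₁ (hunion ▸ hx₁) rfl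
    refine ⟨x₂, S₂, hS₂, ?_, hSp₂, fun z hz => ?_, hx₂⟩
    · refine hsub₂.trans (union_subset (hsub₁.trans ?_) ?_)
      · refine union_subset_union_right _ ?_
        exact subset_biUnion_of_mem (u := fun c : (ι → ℤ) × Finset ι => gridCell c.1 c.2)
          (show W ∈ (𝒞 \ 𝒢 : Finset _) from Finset.mem_sdiff.2 hW)
      · exact subset_union_of_subset_right
          (biUnion_subset_biUnion_left fun c hc => hsdiff.1 hc) _
    · rw [heq₂ (hunion ▸ Or.inl hz), heq₁ hz]

end Induction

section Box

variable [Fintype ι]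

omit [DecidableEq ι] in
lemma mem_closedBall_zero_pi {z : ι → ℝ} {L : ℕ} :
    z ∈ Metric.closedBall (0 : ι → ℝ) L ↔ ∀ i, -(L : ℝ) ≤ z i ∧ z i ≤ L := by
  rw [mem_closedBall_zero_iff, pi_norm_le_iff_of_nonneg (Nat.cast_nonneg L)]
  simp only [Real.norm_eq_abs, abs_le]

lemma finite_gridCell_subset_closedBall (D : Set (ι → ℝ)) (L : ℕ) :
    {c : (ι → ℤ) × Finset ι | gridCell c.1 c.2 ⊆ D ∩ Metric.closedBall 0 L}.Finite := by
  refine ((Set.finite_Icc (fun _ : ι => -(L : ℤ)) fun _ => (L : ℤ)).prod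
    (Set.finite_univ (α := Finset ι))).subset fun c hc => ⟨?_, trivial⟩
  have h : (fun i => (c.1 i : ℝ)) ∈ gridCell c.1 c.2 := mem_gridCell.2 fun i => by
    refine ⟨le_rfl, ?_⟩
    split_ifs <;> simp
  have h' := mem_closedBall_zero_pi.1 (hc h).2
  exact ⟨fun i => by exact_mod_cast (h' i).1, fun i => by exact_mod_cast (h' i).2⟩

lemma exists_mem_gridCell {z : ι → ℝ} {L : ℕ} (hz : z ∈ Metric.closedBall (0 : ι → ℝ) L) :
    ∃ n I, z ∈ gridCell n I ∧ gridCell n I ⊆ Metric.closedBall (0 : ι → ℝ) L := by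
  classical
  refine ⟨fun i => ⌊z i⌋, Finset.univ.filter fun i => Int.fract (z i) ≠ 0,
    mem_gridCell.2 fun i => ?_, fun w hw => ?_⟩
  · refine ⟨Int.floor_le _, ?_⟩
    simp only [Finset.mem_filter, Finset.mem_univ, true_and]
    have := Int.floor_add_fract (z i)
    split_ifs with h
    · linarith [Int.fract_lt_one (z i)]
    · rw [not_not] at h
      linarith
  · rw [mem_closedBall_zero_pi] at hz ⊢
    intro i
    have h1 := mem_gridCell.1 hw i
    simp only [Finset.mem_filter, Finset.mem_univ, true_and] at h1
    have h2 : -(L : ℤ) ≤ ⌊z i⌋ := Int.le_floor.2 (by simpa using (hz i).1)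
    have h2' : -(L : ℝ) ≤ ⌊z i⌋ := by exact_mod_cast h2
    refine ⟨h2'.trans h1.1, h1.2.trans ?_⟩
    have := Int.floor_add_fract (z i)
    split_ifs with h
    · have h3 : ⌊z i⌋ < (L : ℤ) := by
        have : (⌊z i⌋ : ℝ) < L := by
          have := lt_of_le_of_ne (Int.fract_nonneg (z i)) (Ne.symm h)
          linarith [(hz i).2]
        exact_mod_cast this
      exact_mod_cast h3
    · rw [not_not] at h
      linarith [(hz i).2]

lemma norm_sub_le_of_mem_gridCell {n : ι → ℤ} {I : Finset ι} {z w : ι → ℝ}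
    (hz : z ∈ gridCell n I) (hw : w ∈ gridCell n I) : ‖w - z‖ ≤ 1 := by
  refine (pi_norm_le_iff_of_nonneg zero_le_one).2 fun i => ?_
  have h1 := mem_gridCell.1 hz i
  have h2 := mem_gridCell.1 hw i
  rw [Pi.sub_apply, Real.norm_eq_abs, abs_le]
  split_ifs at h1 h2 <;> constructor <;> linarith

/-- A map that is continuous on `D` can be modified near the complement of `D` so as to become
continuous on a box, away from a compact set of points with many fractional parts in `(lo, hi)`. -/
lemma exists_extension_unit_grid [Nonempty X] {p : ℕ} (hX : ∀ j, j + 1 < p → SphereExt X j)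
    {lo hi γ : ℝ} (hlo : 0 ≤ lo) (hγ : lo < γ) (hγ' : γ < hi) (hhi : hi ≤ 1)
    {x : (ι → ℝ) → X} {D : Set (ι → ℝ)} (hx : ContinuousOn x D) (L : ℕ) :
    ∃ (x' : (ι → ℝ) → X) (S : Set (ι → ℝ)), IsCompact S ∧ (∀ z ∈ S, p ≤ fractCount lo hi z) ∧
      ContinuousOn x' (Metric.closedBall 0 L \ S) ∧
      ∀ z ∈ Metric.closedBall (0 : ι → ℝ) L, (∀ w, ‖w - z‖ ≤ 1 → w ∈ D) → x' z = x z ∧ z ∉ S := by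
  let 𝒞 := (finite_gridCell_subset_closedBall (ι := ι) univ L).toFinset
  let 𝒢 := (finite_gridCell_subset_closedBall D L).toFinset
  have h𝒞 : ∀ c, c ∈ 𝒞 ↔ gridCell c.1 c.2 ⊆ Metric.closedBall 0 L := by simp [𝒞]
  have h𝒢 : ∀ c, c ∈ 𝒢 ↔ gridCell c.1 c.2 ⊆ D ∩ Metric.closedBall 0 L := by simp [𝒢]
  obtain ⟨x', S, hS, hsub, hSp, heq, hx'⟩ := exists_extension_complex hX hlo hγ hγ' hhi
    (fun c hc n I hs => (h𝒞 (n, I)).2 (hs.trans ((h𝒞 c).1 hc))) 𝒢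
    (fun c hc n I hs => (h𝒢 (n, I)).2 (hs.trans ((h𝒢 c).1 hc)))
    (fun c hc => (h𝒞 c).2 (((h𝒢 c).1 hc).trans inter_subset_right))
    isClosed_empty (by simp) (x := x) (hx.mono (by
      rintro z ⟨hz, -⟩
      simp only [mem_iUnion] at hz
      obtain ⟨c, hc, hz⟩ := hz
      exact ((h𝒢 c).1 hc hz).1))
  rw [empty_union] at hsub
  refine ⟨x', S, (isCompact_closedBall 0 (L : ℝ)).of_isClosed_subset hS (hsub.trans ?_), hSp,
    hx'.mono (sdiff_subset_sdiff_left ?_), fun z hz hzD => ⟨heq ?_, fun hzS => ?_⟩⟩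
  · refine iUnion₂_subset fun c hc => (h𝒞 c).1 (Finset.mem_sdiff.1 hc).1
  · intro z hz
    obtain ⟨n, I, h1, h2⟩ := exists_mem_gridCell hz
    simp only [mem_iUnion]
    exact ⟨(n, I), (h𝒞 _).2 h2, h1⟩
  · obtain ⟨n, I, h1, h2⟩ := exists_mem_gridCell hz
    simp only [mem_iUnion]
    exact ⟨(n, I), (h𝒢 _).2 (subset_inter
      (fun w hw => hzD w (norm_sub_le_of_mem_gridCell h1 hw)) h2), h1⟩
  · have := hsub hzS
    simp only [mem_iUnion] at this
    obtain ⟨c, hc, hzc⟩ := this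
    rw [Finset.mem_sdiff] at hc
    exact hc.2 ((h𝒢 c).2 (subset_inter
      (fun w hw => hzD w (norm_sub_le_of_mem_gridCell hzc hw)) ((h𝒞 c).1 hc.1)))

/-- `exists_extension_unit_grid` for the grid of mesh `1 / N`. -/
lemma exists_extension_box [Nonempty X] {p : ℕ} (hX : ∀ j, j + 1 < p → SphereExt X j)
    {lo hi γ : ℝ} (hlo : 0 ≤ lo) (hγ : lo < γ) (hγ' : γ < hi) (hhi : hi ≤ 1)
    {x : (ι → ℝ) → X} {D : Set (ι → ℝ)} (hx : ContinuousOn x D) (R : ℕ) {N : ℕ} (hN : 0 < N) :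
    ∃ (x' : (ι → ℝ) → X) (S : Set (ι → ℝ)), IsCompact S ∧
      (∀ v ∈ S, p ≤ fractCount lo hi ((N : ℝ) • v)) ∧
      ContinuousOn x' (Metric.closedBall 0 R \ S) ∧
      ∀ v ∈ Metric.closedBall (0 : ι → ℝ) R, (∀ w, ‖w - v‖ ≤ 1 / N → w ∈ D) →
        x' v = x v ∧ v ∉ S := by
  have hN' : (0 : ℝ) < N := Nat.cast_pos.2 hN
  obtain ⟨x', S, hS, hSp, hx', h⟩ := exists_extension_unit_grid hX hlo hγ hγ' hhi
    (x := fun z => x ((N : ℝ)⁻¹ • z)) (D := (fun z => (N : ℝ)⁻¹ • z) ⁻¹' D)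
    (hx.comp (continuous_const_smul _).continuousOn fun _ hz => hz) (N * R)
  have hball : ∀ v ∈ Metric.closedBall (0 : ι → ℝ) R,
      (N : ℝ) • v ∈ Metric.closedBall (0 : ι → ℝ) (N * R : ℕ) := by
    intro v hv
    rw [mem_closedBall_zero_iff] at hv ⊢
    rw [norm_smul, Real.norm_of_nonneg hN'.le, Nat.cast_mul]
    gcongr
  refine ⟨fun v => x' ((N : ℝ) • v), (fun v => (N : ℝ) • v) ⁻¹' S,
    (Homeomorph.smulOfNeZero (N : ℝ) hN'.ne').isCompact_preimage.2 hS, fun v hv => hSp _ hv,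
    hx'.comp (continuous_const_smul _).continuousOn fun v hv => ⟨hball v hv.1, hv.2⟩,
    fun v hv hvD => ?_⟩
  have := h _ (hball v hv) fun w hw => hvD _ ?_
  · simpa [inv_smul_smul₀ hN'.ne'] using this
  · have : (N : ℝ)⁻¹ • w - v = (N : ℝ)⁻¹ • (w - (N : ℝ) • v) := by
      rw [smul_sub, inv_smul_smul₀ hN'.ne']
    rw [this, norm_smul, norm_inv, Real.norm_of_nonneg hN'.le, one_div]
    exact mul_le_of_le_one_right (inv_nonneg.2 hN'.le) hw

end Box

end Grid

section Separation

variable {m : ℕ}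

lemma fractCount_le_tail (lo hi : ℝ) (v : Fin (m + 1) → ℝ) :
    fractCount lo hi v ≤ fractCount lo hi (Fin.tail v) + 1 := by
  simp only [fractCount, Finset.card_filter, Fin.sum_univ_succ, Fin.tail]
  rw [add_comm]
  gcongr
  · exact (Finset.card_filter _ _).ge
  · split_ifs <;> simp

lemma fractCount_add_le {ι : Type*} [Fintype ι] (lo mid hi : ℝ) (w : ι → ℝ) :
    fractCount mid hi w + fractCount lo mid w ≤ Fintype.card ι := by
  classical
  unfold fractCount
  rw [← Finset.card_union_of_disjoint]
  · exact Finset.card_le_univ _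
  · rw [Finset.disjoint_filter]
    rintro i - h h'
    linarith [h.1, h'.2]

/-- Compact sets of points with many fractional parts above, respectively below, `mid` can be
separated by a function not depending on the first coordinate. -/
lemma exists_separating_tail {p q N : ℕ} {lo mid hi : ℝ} (hpq : m + 3 ≤ p + q)
    {S T : Set (Fin (m + 1) → ℝ)} (hS : IsCompact S) (hT : IsCompact T)
    (hSp : ∀ v ∈ S, p ≤ fractCount mid hi ((N : ℝ) • v))
    (hTq : ∀ v ∈ T, q ≤ fractCount lo mid ((N : ℝ) • v)) :
    ∃ θ : (Fin m → ℝ) → ℝ, Continuous θ ∧ (∀ v ∈ S, θ (Fin.tail v) = 1) ∧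
      ∀ v ∈ T, θ (Fin.tail v) = 0 := by
  have htail : Continuous (Fin.tail : (Fin (m + 1) → ℝ) → Fin m → ℝ) :=
    continuous_pi fun i => continuous_apply i.succ
  obtain ⟨θ, h0, h1, -⟩ := exists_continuous_zero_one_of_isClosed
    (hT.image htail).isClosed (hS.image htail).isClosed (by
      rw [Set.disjoint_left]
      rintro _ ⟨v, hv, rfl⟩ ⟨w, hw, hvw⟩
      have h1 := (hTq v hv).trans (fractCount_le_tail _ _ _)
      have h2 := (hSp w hw).trans (fractCount_le_tail _ _ _)
      have hvw' : Fin.tail ((N : ℝ) • w) = Fin.tail ((N : ℝ) • v) := by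
        change (N : ℝ) • Fin.tail w = (N : ℝ) • Fin.tail v
        rw [hvw]
      rw [hvw'] at h2
      have h3 := fractCount_add_le lo mid hi (Fin.tail ((N : ℝ) • v))
      rw [Fintype.card_fin] at h3
      omega)
  exact ⟨θ, θ.continuous, fun v hv => h1 (mem_image_of_mem _ hv),
    fun v hv => h0 (mem_image_of_mem _ hv)⟩

end Separation

namespace TopJoin

variable {X Y : Type*} [TopologicalSpace X] [TopologicalSpace Y] {m : ℕ}

/-- A map from Euclidean space to a join that is constant outside a box has approximate coordinate
maps that are continuous outside sets separated by a function not depending on the first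
coordinate. -/
lemma exists_approximate_coords [Nonempty X] [Nonempty Y] {p q : ℕ}
    (hX : ∀ j, j + 1 < p → SphereExt X j) (hY : ∀ j, j + 1 < q → SphereExt Y j)
    (hpq : m + 3 ≤ p + q) {F : (Fin (m + 1) → ℝ) → TopJoin X Y} (hF : Continuous F)
    {P : TopJoin X Y} (hP : ∀ v, 2 ≤ ‖v‖ → F v = P) :
    ∃ (x : (Fin (m + 1) → ℝ) → X) (y : (Fin (m + 1) → ℝ) → Y) (A B : Set (Fin (m + 1) → ℝ))
      (θ : (Fin m → ℝ) → ℝ), Continuous θ ∧ ContinuousOn x A ∧ ContinuousOn y B ∧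
      ∀ v, ‖v‖ ≤ 3 →
        (θ (Fin.tail v) < 1 → v ∈ A) ∧ (0 < θ (Fin.tail v) → v ∈ B) ∧
        (height (F v) ≤ 9 / 10 → v ∈ A ∧ x v = fstCoord (F v)) ∧
        (1 / 10 ≤ height (F v) → v ∈ B ∧ y v = sndCoord (F v)) ∧
        (3 ≤ ‖v‖ → (v ∈ A ∧ x v = fstCoord P) ∧ v ∈ B ∧ y v = sndCoord P) := by
  have hh : Continuous fun v => height (F v) := continuous_height.comp hF
  have huc : UniformContinuousOn (fun v => height (F v)) (Metric.closedBall 0 4) :=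
    (isCompact_closedBall _ _).uniformContinuousOn_of_continuous hh.continuousOn
  obtain ⟨δ, hδ, huc⟩ := Metric.uniformContinuousOn_iff.1 huc (1 / 10) (by norm_num)
  obtain ⟨N, hN⟩ := exists_nat_one_div_lt (lt_min hδ (show (0 : ℝ) < 1 / 10 by norm_num))
  rw [lt_min_iff] at hN
  have hcast : ((N + 1 : ℕ) : ℝ) = N + 1 := by push_cast; rfl
  have houter : IsOpen {v : Fin (m + 1) → ℝ | 2 < ‖v‖} := isOpen_lt continuous_const continuous_norm
  have hx : ContinuousOn (fun v => fstCoord (F v)) ({v | height (F v) < 1} ∪ {v | 2 < ‖v‖}) := by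
    refine ContinuousOn.union_of_isOpen (continuousOn_fstCoord.comp hF.continuousOn fun _ h => h)
      ?_ (isOpen_lt hh continuous_const) houter
    exact continuousOn_const.congr fun v hv => congrArg fstCoord (hP v (le_of_lt hv))
  have hy : ContinuousOn (fun v => sndCoord (F v)) ({v | 0 < height (F v)} ∪ {v | 2 < ‖v‖}) := by
    refine ContinuousOn.union_of_isOpen (continuousOn_sndCoord.comp hF.continuousOn fun _ h => h)
      ?_ (isOpen_lt continuous_const hh) houter
    exact continuousOn_const.congr fun v hv => congrArg sndCoord (hP v (le_of_lt hv))
  obtain ⟨x, S, hS, hSp, hxS, hxF⟩ := exists_extension_box hX (lo := 1 / 2) (hi := 1) (γ := 3 / 4)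
    (by norm_num) (by norm_num) (by norm_num) (by norm_num) hx 3 N.succ_pos
  obtain ⟨y, T, hT, hTq, hyT, hyF⟩ := exists_extension_box hY (lo := 0) (hi := 1 / 2) (γ := 1 / 4)
    (by norm_num) (by norm_num) (by norm_num) (by norm_num) hy 3 N.succ_pos
  obtain ⟨θ, hθ, hθS, hθT⟩ := exists_separating_tail hpq hS hT hSp hTq
  have hnear : ∀ v w : Fin (m + 1) → ℝ, ‖v‖ ≤ 3 → ‖w - v‖ ≤ 1 / (N.succ : ℕ) →
      |height (F w) - height (F v)| < 1 / 10 ∧ (3 ≤ ‖v‖ → 2 < ‖w‖) := by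
    intro v w hv hw
    rw [Nat.succ_eq_add_one, hcast] at hw
    have h1 := norm_sub_norm_le w v
    have h2 := norm_sub_norm_le v w
    rw [norm_sub_rev] at h2
    refine ⟨huc w ?_ v ?_ ?_, fun h => ?_⟩
    · rw [mem_closedBall_zero_iff]
      linarith [hN.2]
    · rw [mem_closedBall_zero_iff]
      linarith
    · rw [dist_eq_norm]
      linarith [hN.1]
    · linarith [hN.2]
  refine ⟨x, y, Metric.closedBall 0 (3 : ℕ) \ S, Metric.closedBall 0 (3 : ℕ) \ T, θ, hθ, hxS, hyT,
    fun v hv => ?_⟩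
  have hv' : v ∈ Metric.closedBall (0 : Fin (m + 1) → ℝ) (3 : ℕ) := by
    rw [mem_closedBall_zero_iff]
    exact_mod_cast hv
  refine ⟨fun h => ⟨hv', fun hvS => (hθS v hvS ▸ h).false⟩,
    fun h => ⟨hv', fun hvT => (hθT v hvT ▸ h).false⟩, fun h => ?_, fun h => ?_, fun h => ?_⟩
  · obtain ⟨h1, h2⟩ := hxF v hv' fun w hw => Or.inl (by
      have := abs_lt.1 (hnear v w hv hw).1
      change height (F w) < 1
      linarith [this.2])
    exact ⟨⟨hv', h2⟩, h1⟩
  · obtain ⟨h1, h2⟩ := hyF v hv' fun w hw => Or.inl (by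
      have := abs_lt.1 (hnear v w hv hw).1
      change 0 < height (F w)
      linarith [this.1])
    exact ⟨⟨hv', h2⟩, h1⟩
  · obtain ⟨h1, h2⟩ := hxF v hv' fun w hw => Or.inr ((hnear v w hv hw).2 h)
    obtain ⟨h3, h4⟩ := hyF v hv' fun w hw => Or.inr ((hnear v w hv hw).2 h)
    simp only [hP v (by linarith)] at h1 h3
    exact ⟨⟨⟨hv', h2⟩, h1⟩, ⟨hv', h4⟩, h3⟩

/-- Extension of `x ∘ u` by a constant from the half-space `0 ≤ h`. -/
lemma continuousOn_ite_nonneg {T V Z : Type*} [TopologicalSpace T] [TopologicalSpace V]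
    [TopologicalSpace Z] {h : T → ℝ} (hh : Continuous h) {u : T → V} (hu : Continuous u)
    {x : V → Z} {A : Set V} (hx : ContinuousOn x A) {x₀ : Z} {O : Set T}
    (hO : ∀ z ∈ O, 0 ≤ h z → u z ∈ A) (h0 : ∀ z, h z = 0 → x (u z) = x₀) :
    ContinuousOn (fun z => if 0 ≤ h z then x (u z) else x₀) O := by
  refine ContinuousOn.if (fun z hz => ?_) ?_ continuousOn_const
  · exact h0 z (frontier_le_subset_eq continuous_const hh hz.2).symm
  · rw [(isClosed_le continuous_const hh).closure_eq]
    exact hx.comp hu.continuousOn fun z hz => hO z hz.1 hz.2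

/-- Replace the first coordinate of a vector by its image under a map of the interval. -/
def reparam (α : ℝ → ℝ) (v : Fin (m + 1) → ℝ) : Fin (m + 1) → ℝ :=
  Fin.cons (α (v 0)) (Fin.tail v)

lemma norm_reparam_le {α : ℝ → ℝ} (hα : ∀ s, |s| ≤ 3 → |α s| ≤ 3) {v : Fin (m + 1) → ℝ}
    (hv : ‖v‖ ≤ 3) : ‖reparam α v‖ ≤ 3 := by
  rw [pi_norm_le_iff_of_nonneg (by norm_num)] at hv ⊢
  exact Fin.cases (hα _ (hv 0)) fun i => hv i.succ

lemma three_le_norm_reparam {α : ℝ → ℝ} (hα : ∀ s, |s| = 3 → |α s| = 3) {v : Fin (m + 1) → ℝ}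
    {i : Fin (m + 1)} (hv : |v i| = 3) : 3 ≤ ‖reparam α v‖ := by
  revert hv
  refine Fin.cases (fun hv => ?_) (fun i hv => ?_) i
  · exact (hα _ hv).ge.trans (norm_le_pi_norm (reparam α v) 0)
  · exact hv.ge.trans (norm_le_pi_norm (reparam α v) i.succ)

/-- A map into a join that factors through a box, being constant near its boundary, is
nullhomotopic, provided `X` and `Y` are sufficiently connected. -/
lemma homot_const_of_box [Nonempty X] [Nonempty Y] {p q : ℕ}
    (hX : ∀ j, j + 1 < p → SphereExt X j) (hY : ∀ j, j + 1 < q → SphereExt Y j)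
    (hpq : m + 3 ≤ p + q) {F : (Fin (m + 1) → ℝ) → TopJoin X Y} (hF : Continuous F)
    {P : TopJoin X Y} (hP : ∀ v, 2 ≤ ‖v‖ → F v = P) {M : Type*} [TopologicalSpace M]
    {c : M → Fin (m + 1) → ℝ} (hc : Continuous c) (hc3 : ∀ z, ‖c z‖ ≤ 3)
    {h : M → ℝ} (hh : Continuous h) (hch : ∀ z, h z = 0 → ∃ i, |c z i| = 3)
    {f : M → TopJoin X Y} (hf : Continuous f) (hfF : ∀ z, 0 ≤ h z → f z = F (c z))
    (hfP : ∀ z, h z < 0 → f z = P) : ∃ Q, Homot f fun _ => Q := by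
  obtain ⟨x, y, A, B, θ, hθ, hxA, hyB, key⟩ := exists_approximate_coords hX hY hpq hF hP
  have htail : Continuous (Fin.tail : (Fin (m + 1) → ℝ) → Fin m → ℝ) :=
    continuous_pi fun i => continuous_apply i.succ
  let α : ℝ → ℝ → ℝ := fun r s => min 3 ((1 + 2 * r) * s + 6 * r)
  let β : ℝ → ℝ → ℝ := fun r s => max (-3) ((1 + 2 * r) * s - 6 * r)
  have hα3 : ∀ r ∈ unitInterval, (∀ s, |s| ≤ 3 → |α r s| ≤ 3) ∧ ∀ s, |s| = 3 → |α r s| = 3 := by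
    rintro r ⟨hr, hr'⟩
    refine ⟨fun s hs => ?_, fun s hs => ?_⟩
    · rw [abs_le] at hs ⊢
      exact ⟨le_min (by norm_num) (by nlinarith [hs.1]), min_le_left _ _⟩
    · rcases (abs_eq (by norm_num)).1 hs with rfl | rfl
      · simp only [α]
        rw [min_eq_left (by linarith)]
        norm_num
      · simp only [α]
        rw [min_eq_right (by linarith)]
        ring_nf
        norm_num
  have hβ3 : ∀ r ∈ unitInterval, (∀ s, |s| ≤ 3 → |β r s| ≤ 3) ∧ ∀ s, |s| = 3 → |β r s| = 3 := by
    rintro r ⟨hr, hr'⟩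
    refine ⟨fun s hs => ?_, fun s hs => ?_⟩
    · rw [abs_le] at hs ⊢
      exact ⟨le_max_left _ _, max_le (by norm_num) (by nlinarith [hs.2])⟩
    · rcases (abs_eq (by norm_num)).1 hs with rfl | rfl
      · simp only [β]
        rw [max_eq_right (by linarith)]
        ring_nf
        norm_num
      · simp only [β]
        rw [max_eq_left (by linarith)]
        norm_num
  let xx : M → ℝ → X := fun z r => if 0 ≤ h z then x (reparam (α r) (c z)) else fstCoord P
  let yy : M → ℝ → Y := fun z r => if 0 ≤ h z then y (reparam (β r) (c z)) else sndCoord P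
  have hux : Continuous fun w : M × unitInterval => reparam (α w.2) (c w.1) := by
    refine continuous_pi (Fin.cases ?_ fun i => ?_)
    · change Continuous fun w : M × unitInterval => min 3 ((1 + 2 * (w.2 : ℝ)) * c w.1 0 + 6 * w.2)
      fun_prop
    · change Continuous fun w : M × unitInterval => c w.1 i.succ
      fun_prop
  have huy : Continuous fun w : M × unitInterval => reparam (β w.2) (c w.1) := by
    refine continuous_pi (Fin.cases ?_ fun i => ?_)
    · change Continuous fun w : M × unitInterval =>
        max (-3) ((1 + 2 * (w.2 : ℝ)) * c w.1 0 - 6 * w.2)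
      fun_prop
    · change Continuous fun w : M × unitInterval => c w.1 i.succ
      fun_prop
  have hxc : ∀ O : Set (M × unitInterval), (∀ w ∈ O, 0 ≤ h w.1 → reparam (α w.2) (c w.1) ∈ A) →
      ContinuousOn (fun w : M × unitInterval => xx w.1 w.2) O := fun O hO =>
    continuousOn_ite_nonneg (hh.comp continuous_fst) hux hxA hO fun w hw => by
      obtain ⟨i, hi⟩ := hch _ hw
      exact ((key _ (norm_reparam_le (hα3 _ w.2.2).1 (hc3 _))).2.2.2.2
        (three_le_norm_reparam (hα3 _ w.2.2).2 hi)).1.2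
  have hyc : ∀ O : Set (M × unitInterval), (∀ w ∈ O, 0 ≤ h w.1 → reparam (β w.2) (c w.1) ∈ B) →
      ContinuousOn (fun w : M × unitInterval => yy w.1 w.2) O := fun O hO =>
    continuousOn_ite_nonneg (hh.comp continuous_fst) huy hyB hO fun w hw => by
      obtain ⟨i, hi⟩ := hch _ hw
      exact ((key _ (norm_reparam_le (hβ3 _ w.2.2).1 (hc3 _))).2.2.2.2
        (three_le_norm_reparam (hβ3 _ w.2.2).2 hi)).2.2
  have hxs : ∀ (r : unitInterval) (O : Set M), (∀ z ∈ O, 0 ≤ h z → reparam (α r) (c z) ∈ A) →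
      ContinuousOn (fun z => xx z r) O := fun r O hO =>
    (hxc (O ×ˢ {r}) (by rintro ⟨z, _⟩ ⟨hz, rfl⟩; exact hO z hz)).comp
      (Continuous.prodMk_left r).continuousOn fun z hz => ⟨hz, rfl⟩
  have hys : ∀ (r : unitInterval) (O : Set M), (∀ z ∈ O, 0 ≤ h z → reparam (β r) (c z) ∈ B) →
      ContinuousOn (fun z => yy z r) O := fun r O hO =>
    (hyc (O ×ˢ {r}) (by rintro ⟨z, _⟩ ⟨hz, rfl⟩; exact hO z hz)).comp
      (Continuous.prodMk_left r).continuousOn fun z hz => ⟨hz, rfl⟩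
  have hα0 : ∀ z, reparam (α 0) (c z) = c z := by
    intro z
    have : α 0 (c z 0) = c z 0 := by
      have := (abs_le.1 ((norm_le_pi_norm (c z) 0).trans (hc3 z))).2
      simp only [α, mul_zero, add_zero, one_mul]
      exact min_eq_right this
    rw [reparam, this]
    exact Fin.cons_self_tail _
  have hβ0 : ∀ z, reparam (β 0) (c z) = c z := by
    intro z
    have : β 0 (c z 0) = c z 0 := by
      have := (abs_le.1 ((norm_le_pi_norm (c z) 0).trans (hc3 z))).1
      simp only [β, mul_zero, add_zero, one_mul, sub_zero]
      exact max_eq_right this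
    rw [reparam, this]
    exact Fin.cons_self_tail _
  have hα1 : ∀ z, -1 < c z 0 → reparam (α 1) (c z) ∈ A ∧ x (reparam (α 1) (c z)) = fstCoord P := by
    intro z hz
    refine ((key _ (norm_reparam_le (hα3 1 unitInterval.one_mem).1 (hc3 _))).2.2.2.2 ?_).1
    refine le_trans (le_of_eq ?_) (norm_le_pi_norm (reparam (α 1) (c z)) 0)
    change 3 = |min 3 ((1 + 2 * 1) * c z 0 + 6 * 1)|
    rw [min_eq_left (by linarith)]
    norm_num
  have hβ1 : ∀ z, c z 0 < 1 → reparam (β 1) (c z) ∈ B ∧ y (reparam (β 1) (c z)) = sndCoord P := by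
    intro z hz
    refine ((key _ (norm_reparam_le (hβ3 1 unitInterval.one_mem).1 (hc3 _))).2.2.2.2 ?_).2
    refine le_trans (le_of_eq ?_) (norm_le_pi_norm (reparam (β 1) (c z)) 0)
    change 3 = |max (-3) ((1 + 2 * 1) * c z 0 - 6 * 1)|
    rw [max_eq_left (by linarith)]
    norm_num
  let τ : M → ℝ := fun z => 3 * height (f z) - 1
  let ϑ : M → ℝ := fun z => θ (Fin.tail (c z))
  let μ : M → ℝ := fun z => (1 - c z 0) / 2
  have hτ : Continuous τ := (continuous_const.mul (continuous_height.comp hf)).sub continuous_const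
  have hϑ : Continuous ϑ := hθ.comp (htail.comp hc)
  have hμ : Continuous μ := by
    have : Continuous fun z => c z 0 := (continuous_apply 0).comp hc
    fun_prop
  have e₁ : (fun z => mk (fstCoord (f z)) (sndCoord (f z)) (stretch (3 * height (f z) - 1))) =
      fun z => mk (xx z (0 : unitInterval)) (yy z (0 : unitInterval)) (stretch (τ z)) := by
    funext z
    simp only [xx, yy, Set.Icc.coe_zero, hα0, hβ0, τ]
    split_ifs with hz
    · have k := key _ (hc3 z)
      rw [hfF z hz]
      rcases le_or_gt (height (F (c z))) (9 / 10) with h1 | h1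
      · rw [(k.2.2.1 h1).2]
        rcases le_or_gt (1 / 10) (height (F (c z))) with h2 | h2
        · rw [(k.2.2.2.1 h2).2]
        · rw [stretch_of_le (by linarith)]
          exact mk_zero _ _ _
      · rw [stretch_of_ge (by linarith), (k.2.2.2.1 (by linarith)).2]
        exact mk_one _ _ _
    · rw [hfP z (not_le.1 hz)]
  have e₂ : (fun z => mk (xx z (1 : unitInterval)) (yy z (1 : unitInterval)) (stretch (μ z))) =
      fun z => mk (fstCoord P) (sndCoord P) (stretch (μ z)) := by
    funext z
    simp only [xx, yy, Set.Icc.coe_one, μ]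
    split_ifs with hz
    · rcases lt_or_ge (-1) (c z 0) with h1 | h1
      · rw [(hα1 z h1).2]
        rcases lt_or_ge (c z 0) 1 with h2 | h2
        · rw [(hβ1 z h2).2]
        · rw [stretch_of_le (by linarith)]
          exact mk_zero _ _ _
      · rw [stretch_of_ge (by linarith), (hβ1 z (by linarith)).2]
        exact mk_one _ _ _
    · rfl
  have a₁ := homot_self_stretch hf
  have a₂ := homot_height (x := fun z => xx z (0 : unitInterval))
    (y := fun z => yy z (0 : unitInterval)) hτ hϑ
    (hxs 0 _ fun z hz h0 => by
      simp only [Set.Icc.coe_zero, hα0]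
      refine ((key _ (hc3 z)).2.2.1 ?_).1
      rw [← hfF z h0]
      have : 3 * height (f z) - 1 < 1 := hz
      linarith)
    (hxs 0 _ fun z hz _ => by
      simp only [Set.Icc.coe_zero, hα0]
      exact (key _ (hc3 z)).1 hz)
    (hys 0 _ fun z hz h0 => by
      simp only [Set.Icc.coe_zero, hβ0]
      refine ((key _ (hc3 z)).2.2.2.1 ?_).1
      rw [← hfF z h0]
      have : 0 < 3 * height (f z) - 1 := hz
      linarith)
    (hys 0 _ fun z hz _ => by
      simp only [Set.Icc.coe_zero, hβ0]
      exact (key _ (hc3 z)).2.1 hz)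
  have a₃ : Homot (fun z => mk (xx z (0 : unitInterval)) (yy z (0 : unitInterval)) (stretch (ϑ z)))
      fun z => mk (xx z (1 : unitInterval)) (yy z (1 : unitInterval)) (stretch (ϑ z)) := by
    refine ⟨fun w => mk (xx w.1 w.2) (yy w.1 w.2) (stretch (ϑ w.1)),
      continuous_mk_stretch (x := fun w : M × unitInterval => xx w.1 w.2)
        (y := fun w => yy w.1 w.2) (hϑ.comp continuous_fst) ?_ ?_, fun _ => rfl, fun _ => rfl⟩
    · exact hxc _ fun w hw _ => (key _ (norm_reparam_le (hα3 _ w.2.2).1 (hc3 _))).1 hw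
    · exact hyc _ fun w hw _ => (key _ (norm_reparam_le (hβ3 _ w.2.2).1 (hc3 _))).2.1 hw
  have a₄ := homot_height (x := fun z => xx z (1 : unitInterval))
    (y := fun z => yy z (1 : unitInterval)) hϑ hμ
    (hxs 1 _ fun z hz _ => (key _ (norm_reparam_le (hα3 _ unitInterval.one_mem).1 (hc3 _))).1 hz)
    (hxs 1 _ fun z hz _ => (hα1 z (by
      have : (1 - c z 0) / 2 < 1 := hz
      linarith)).1)
    (hys 1 _ fun z hz _ => (key _ (norm_reparam_le (hβ3 _ unitInterval.one_mem).1 (hc3 _))).2.1 hz)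
    (hys 1 _ fun z hz _ => (hβ1 z (by
      have : 0 < (1 - c z 0) / 2 := hz
      linarith)).1)
  exact ⟨mk (fstCoord P) (sndCoord P) 1, (e₁ ▸ a₁).trans (a₂.trans (a₃.trans ((e₂ ▸ a₄).trans
    (homot_const_of_continuous continuous_const continuous_const hμ _ _))))⟩

end TopJoin

section Sphere

variable {n : ℕ}

/-- The unit vector in the direction of `u`. -/
def unitVector {M : Type*} (u : M → EuclideanSpace ℝ (Fin n)) (hu : ∀ a, u a ≠ 0) (a : M) :
    Metric.sphere (0 : EuclideanSpace ℝ (Fin n)) 1 :=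
  ⟨‖u a‖⁻¹ • u a, by simp [norm_smul, hu a]⟩

lemma continuous_unitVector {M : Type*} [TopologicalSpace M] {u : M → EuclideanSpace ℝ (Fin n)}
    (huc : Continuous u) (hu : ∀ a, u a ≠ 0) : Continuous (unitVector u hu) :=
  ((huc.norm.inv₀ fun a => norm_ne_zero_iff.2 (hu a)).smul huc).subtype_mk _

lemma exists_abs_eq_norm (v : Fin (n + 1) → ℝ) : ∃ i, |v i| = ‖v‖ := by
  obtain ⟨i, -, hi⟩ := Finset.exists_max_image Finset.univ (fun i => |v i|) Finset.univ_nonempty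
  refine ⟨i, le_antisymm (norm_le_pi_norm v i) ?_⟩
  exact (pi_norm_le_iff_of_nonneg (abs_nonneg _)).2 fun k => hi k (Finset.mem_univ k)

open TopJoin in
/-- Every map from a sphere is homotopic to one that is constant on `z 0 ≤ 1 / 2`. -/
lemma exists_homot_const_on_cap {Z : Type*} [TopologicalSpace Z]
    {f : Metric.sphere (0 : EuclideanSpace ℝ (Fin (n + 1))) 1 → Z} (hf : Continuous f) :
    ∃ (g : Metric.sphere (0 : EuclideanSpace ℝ (Fin (n + 1))) 1 → Z) (P : Z), Continuous g ∧
      Homot f g ∧ ∀ z, z.1 0 ≤ 1 / 2 → g z = P := by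
  let S := Metric.sphere (0 : EuclideanSpace ℝ (Fin (n + 1))) 1
  have hS : ∀ z : S, ‖z.1‖ = 1 := fun z => mem_sphere_zero_iff_norm.1 z.2
  have hS0 : ∀ z : S, z.1 0 ≤ 1 := fun z =>
    (le_abs_self _).trans ((PiLp.norm_apply_le z.1 0).trans (hS z).le)
  let e : EuclideanSpace ℝ (Fin (n + 1)) := EuclideanSpace.single 0 1
  have he : ‖e‖ = 1 := by simp [e]
  let a : S × unitInterval → ℝ := fun w => (1 - w.2) + w.2 * max 0 (2 * w.1.1 0 - 1)
  have ha : Continuous a := by fun_prop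
  let u : S × unitInterval → EuclideanSpace ℝ (Fin (n + 1)) := fun w =>
    a w • w.1.1 - (1 - a w) • e
  have hu : ∀ w, u w ≠ 0 := by
    rintro w hw
    have h1 : 0 ≤ a w := add_nonneg (by linarith [w.2.2.2]) (mul_nonneg w.2.2.1 (le_max_left _ _))
    have h2 : a w ≤ 1 := by
      have : max 0 (2 * w.1.1 0 - 1) ≤ 1 := max_le zero_le_one (by linarith [hS0 w.1])
      have := mul_le_mul_of_nonneg_left this w.2.2.1
      simp only [a]
      linarith
    have h3 : a w • w.1.1 = (1 - a w) • e := sub_eq_zero.1 hw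
    have h4 := congrArg norm h3
    rw [norm_smul, norm_smul, hS, he, Real.norm_of_nonneg h1, Real.norm_of_nonneg (by linarith)]
      at h4
    have h5 : a w = 1 / 2 := by linarith
    rw [h5] at h3
    norm_num at h3
    have h6 : w.1.1 = e := smul_right_injective _ (by norm_num : (1 / 2 : ℝ) ≠ 0) (by simpa using h3)
    have h7 : a w = 1 := by
      simp only [a, h6, e]
      norm_num
    linarith
  have huc : Continuous u := by fun_prop
  refine ⟨fun z => f (unitVector u hu (z, 1)), f ⟨-e, by simp [he]⟩,
    hf.comp ((continuous_unitVector huc hu).comp (Continuous.prodMk_left 1)),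
    ⟨fun w => f (unitVector u hu w), hf.comp (continuous_unitVector huc hu), fun z => ?_,
      fun z => rfl⟩, fun z hz => ?_⟩
  · refine congrArg f (Subtype.ext ?_)
    have : u (z, 0) = z.1 := by simp [u, a]
    simp only [unitVector]
    rw [this, hS, inv_one, one_smul]
  · refine congrArg f (Subtype.ext ?_)
    have : u (z, 1) = -e := by
      have : a (z, 1) = 0 := by
        simp only [a, Set.Icc.coe_one, sub_self, zero_add, one_mul]
        exact max_eq_left (by linarith)
      simp [u, this]
    simp only [unitVector]
    rw [this, norm_neg, he, inv_one, one_smul]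

end Sphere

namespace TopJoin

variable {X Y : Type*} [TopologicalSpace X] [TopologicalSpace Y] {m : ℕ}

lemma homot_const_of_sphere_succ [Nonempty X] [Nonempty Y] {p q : ℕ}
    (hX : ∀ j, j + 1 < p → SphereExt X j) (hY : ∀ j, j + 1 < q → SphereExt Y j)
    (hpq : m + 3 ≤ p + q)
    {f : Metric.sphere (0 : EuclideanSpace ℝ (Fin (m + 1 + 1))) 1 → TopJoin X Y}
    (hf : Continuous f) : ∃ Q, Homot f fun _ => Q := by
  obtain ⟨g, P, hg, hfg, hgP⟩ := exists_homot_const_on_cap hf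
  let S := Metric.sphere (0 : EuclideanSpace ℝ (Fin (m + 1 + 1))) 1
  have hS : ∀ z : S, ‖z.1‖ = 1 := fun z => mem_sphere_zero_iff_norm.1 z.2
  let u : (Fin (m + 1) → ℝ) → EuclideanSpace ℝ (Fin (m + 1 + 1)) := fun v =>
    WithLp.toLp 2 (Fin.cons 1 v)
  have huc : Continuous u := by
    refine (PiLp.continuous_toLp 2 _).comp (continuous_pi (Fin.cases ?_ fun i => ?_))
    · exact continuous_const
    · exact continuous_apply i
  have hu : ∀ v, u v ≠ 0 := fun v hv => by
    have : u v 0 = 0 := by rw [hv]; rfl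
    exact one_ne_zero this
  have huv : ∀ v, ‖v‖ ≤ ‖u v‖ := fun v =>
    (pi_norm_le_iff_of_nonneg (norm_nonneg _)).2 fun i => PiLp.norm_apply_le (u v) i.succ
  have hF : Continuous fun v => g (unitVector u hu v) := hg.comp (continuous_unitVector huc hu)
  have hFP : ∀ v, 2 ≤ ‖v‖ → g (unitVector u hu v) = P := by
    intro v hv
    refine hgP _ ?_
    change ‖u v‖⁻¹ * 1 ≤ 1 / 2
    rw [mul_one, one_div]
    exact inv_anti₀ two_pos (hv.trans (huv v))
  let t : S → Fin (m + 1) → ℝ := fun z i => z.1 i.succ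
  have ht : Continuous t := by fun_prop
  have ht1 : ∀ z, ‖t z‖ ≤ 1 := fun z =>
    (pi_norm_le_iff_of_nonneg zero_le_one).2 fun i =>
      (PiLp.norm_apply_le z.1 i.succ).trans (hS z).le
  let d : S → ℝ := fun z => max |z.1 0| (‖t z‖ / 3)
  have hdc : Continuous d := by fun_prop
  have hd : ∀ z, 0 < d z := by
    intro z
    by_contra! hz
    have h1 : z.1 0 = 0 := abs_nonpos_iff.1 ((le_max_left _ _).trans hz)
    have h2 : t z = 0 := norm_le_zero_iff.1 (by linarith [(le_max_right _ _).trans hz])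
    have h3 : z.1 = 0 := by
      ext i
      exact Fin.cases h1 (fun i => congrFun h2 i) i
    have := hS z
    rw [h3, norm_zero] at this
    exact zero_ne_one this
  let c : S → Fin (m + 1) → ℝ := fun z => (d z)⁻¹ • t z
  have hcn : ∀ z, ‖c z‖ = (d z)⁻¹ * ‖t z‖ := fun z => by
    rw [norm_smul, Real.norm_of_nonneg (inv_nonneg.2 (hd z).le)]
  have hc3 : ∀ z, |z.1 0| ≤ ‖t z‖ / 3 → ‖c z‖ = 3 := by
    intro z hz
    have h1 : d z = ‖t z‖ / 3 := max_eq_right hz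
    have h2 := hd z
    rw [hcn, inv_mul_eq_iff_eq_mul₀ h2.ne', h1]
    ring
  obtain ⟨Q, hQ⟩ := homot_const_of_box hX hY hpq hF hFP (c := c) (h := fun z : S => z.1 0) (f := g)
    ((hdc.inv₀ fun z => (hd z).ne').smul ht)
    (fun z => by
      rw [hcn, inv_mul_le_iff₀ (hd z)]
      linarith [le_max_right |z.1 0| (‖t z‖ / 3)])
    (by fun_prop)
    (fun z hz => by
      obtain ⟨i, hi⟩ := exists_abs_eq_norm (c z)
      exact ⟨i, hi.trans (hc3 z (by rw [hz, abs_zero]; positivity))⟩)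
    hg
    (fun z hz => by
      rcases le_or_gt |z.1 0| (‖t z‖ / 3) with h | h
      · rw [hFP _ (by rw [hc3 z h]; norm_num), hgP z]
        linarith [le_abs_self (z.1 0), ht1 z]
      · have h1 : d z = z.1 0 := (max_eq_left h.le).trans (abs_of_nonneg hz)
        have h0 : 0 < z.1 0 := h1 ▸ hd z
        have h2 : u (c z) = (z.1 0)⁻¹ • z.1 := by
          ext i
          refine Fin.cases ?_ (fun i => ?_) i
          · change 1 = (z.1 0)⁻¹ * z.1 0
            rw [inv_mul_cancel₀ h0.ne']
          · change (d z)⁻¹ * z.1 i.succ = (z.1 0)⁻¹ * z.1 i.succ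
            rw [h1]
        congr 1
        refine Subtype.ext ?_
        simp only [unitVector]
        rw [h2, norm_smul, hS, mul_one, norm_inv, inv_inv, Real.norm_of_nonneg hz,
          smul_inv_smul₀ h0.ne'])
    (fun z hz => hgP z (by linarith))
  exact ⟨Q, hfg.trans hQ⟩

lemma homot_const_of_discrete [Nonempty X] [Nonempty Y] {M : Type*} [TopologicalSpace M]
    [DiscreteTopology M] (f : M → TopJoin X Y) : ∃ Q, Homot f fun _ => Q := by
  choose x y t h using fun z => mk_surjective (f z)
  have ht : ∀ z, stretch ((t z + 1) / 3) = t z := by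
    intro z
    rw [stretch, show 3 * (((t z : ℝ) + 1) / 3) - 1 = t z by ring, Set.projIcc_val]
  have := homot_const_of_continuous (x := x) (y := y) (τ := fun z => ((t z : ℝ) + 1) / 3)
    continuous_of_discreteTopology continuous_of_discreteTopology continuous_of_discreteTopology
    (Classical.arbitrary X) (Classical.arbitrary Y)
  simp only [ht, h] at this
  exact ⟨_, this⟩

end TopJoin

lemma discreteTopology_sphere_zero :
    DiscreteTopology (Metric.sphere (0 : EuclideanSpace ℝ (Fin (0 + 1))) 1) := by
  have : (Metric.sphere (0 : EuclideanSpace ℝ (Fin (0 + 1))) 1).Finite := by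
    refine (Set.toFinite {EuclideanSpace.single 0 1, EuclideanSpace.single 0 (-1)}).subset ?_
    intro z hz
    rw [mem_sphere_zero_iff_norm, EuclideanSpace.norm_eq, Fin.sum_univ_one, Real.norm_eq_abs,
      sq_abs, Real.sqrt_sq_eq_abs] at hz
    rcases (abs_eq zero_le_one).1 hz with h | h
    · left
      ext i
      fin_cases i
      simpa using h
    · right
      ext i
      fin_cases i
      simpa using h
  have := this.to_subtype
  infer_instance

open TopJoin in
lemma sphereExt_topJoin {X Y : Type*} [TopologicalSpace X] [TopologicalSpace Y] [Nonempty X]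
    [Nonempty Y] {p q : ℕ} (hX : ∀ j, j + 1 < p → SphereExt X j)
    (hY : ∀ j, j + 1 < q → SphereExt Y j) {k : ℕ} (hk : k + 2 ≤ p + q) :
    SphereExt (TopJoin X Y) k := by
  intro f
  obtain ⟨Q, hQ⟩ : ∃ Q, Homot f fun _ => Q := by
    rcases k with - | m
    · have := discreteTopology_sphere_zero
      exact homot_const_of_discrete f
    · exact homot_const_of_sphere_succ hX hY (by omega) f.continuous
  exact exists_ball_extension f hQ

theorem conn_join_ge (X Y : Type*) [TopologicalSpace X] [TopologicalSpace Y]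
    (a b : ℤ) (ha : -1 ≤ a) (hb : -1 ≤ b)
    (hX : NConnected X a) (hY : NConnected Y b) :
    NConnected (TopJoin X Y) (a + b + 2) := by
  have := hX.1 ha
  have := hY.1 hb
  refine ⟨fun _ => ⟨TopJoin.mk (Classical.arbitrary X) (Classical.arbitrary Y) 0⟩, fun k hk => ?_⟩
  exact sphereExt_topJoin (p := (a + 2).toNat) (q := (b + 2).toNat)
    (fun j hj => hX.2 j (by omega)) (fun j hj => hY.2 j (by omega)) (by omega)
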